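/- arXiv:1210.6485 — 3 statements merged into one kernel-verified Lean document; each statement's English description precedes it below -/
import Mathlib

section
/- Let X be a compact subset of ℝ^N that is the underlying space (union of faces) of a finite simplicial complex of dimension at most d. Let ε > 0 and let f : X → ℝ^(2d+1) be any continuous map. Then there exists a topological embedding g : X → ℝ^(2d+1) such that ‖g(x) − f(x)‖ ≤ ε for all x ∈ X. -/
open Module

/-- Let `p` be a `C¹` map and let `x` and `y` run over affine subspaces with directions `V` and `W`.
The coefficient families `a` for which the linear perturbation `x ↦ p x + ∑ i, x i • a i` identifies
some `x` and `y` with `y k < x k` form a set of dimension at most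
`dim V + dim W + (card ι - 1) * dim F`. -/
theorem dimH_setOf_linear_perturbation_eq_le {ι F : Type*} [Fintype ι] [DecidableEq ι]
    [NormedAddCommGroup F] [NormedSpace ℝ F] [FiniteDimensional ℝ F]
    {p : EuclideanSpace ℝ ι → F} (hp : ContDiff ℝ 1 p)
    (V W : Submodule ℝ (EuclideanSpace ℝ ι)) (x₀ y₀ : EuclideanSpace ℝ ι) (k : ι) :
    dimH {a : ι → F | ∃ x y, x - x₀ ∈ V ∧ y - y₀ ∈ W ∧ y k < x k ∧
      p x + ∑ i, x i • a i = p y + ∑ i, y i • a i} ≤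
      ((finrank ℝ V + finrank ℝ W + (Fintype.card ι - 1) * finrank ℝ F : ℕ) : ENNReal) := by
  let u : (V × W) × ({i // i ≠ k} → F) → EuclideanSpace ℝ ι := fun q ↦
    (x₀ + (q.1.1 : EuclideanSpace ℝ ι)) - (y₀ + (q.1.2 : EuclideanSpace ℝ ι))
  let S : Set ((V × W) × ({i // i ≠ k} → F)) := {q | 0 < u q k}
  let Φ : (V × W) × ({i // i ≠ k} → F) → ι → F := fun q i ↦
    if h : i ≠ k then q.2 ⟨i, h⟩ else (u q k)⁻¹ •
      (p (y₀ + (q.1.2 : EuclideanSpace ℝ ι)) - p (x₀ + (q.1.1 : EuclideanSpace ℝ ι)) -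
        ∑ j : {i // i ≠ k}, u q j • q.2 j)
  have hV : ContDiff ℝ 1 fun q : (V × W) × ({i // i ≠ k} → F) ↦
      x₀ + (q.1.1 : EuclideanSpace ℝ ι) :=
    contDiff_const.add (V.subtypeL.contDiff.comp (contDiff_fst.comp contDiff_fst))
  have hW : ContDiff ℝ 1 fun q : (V × W) × ({i // i ≠ k} → F) ↦
      y₀ + (q.1.2 : EuclideanSpace ℝ ι) :=
    contDiff_const.add (W.subtypeL.contDiff.comp (contDiff_snd.comp contDiff_fst))
  have hu (i : ι) : ContDiff ℝ 1 fun q ↦ u q i :=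
    (EuclideanSpace.proj (𝕜 := ℝ) i).contDiff.comp (hV.sub hW)
  have hΦ : ContDiffOn ℝ 1 Φ S := by
    rw [contDiffOn_pi]
    intro i
    by_cases h : i = k
    · simp only [Φ, h, ne_eq, not_true_eq_false, dite_false]
      refine ContDiffOn.smul ((hu k).contDiffOn.inv fun q hq ↦ ne_of_gt hq)
        (ContDiff.contDiffOn ?_)
      refine ((hp.comp hW).sub (hp.comp hV)).sub (ContDiff.sum fun j _ ↦ ?_)
      exact (hu j).smul ((contDiff_apply ℝ F j).comp contDiff_snd)
    · simp only [Φ, h, ne_eq, not_false_eq_true, dite_true]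
      exact ((contDiff_apply ℝ F _).comp contDiff_snd).contDiffOn
  have hS : Convex ℝ S := by
    intro q hq r hr a b ha hb hab
    simp only [S, u, Set.mem_ofPred_eq, PiLp.sub_apply, PiLp.add_apply, Prod.fst_add, Prod.snd_add,
      Prod.smul_fst, Prod.smul_snd, Submodule.coe_add, Submodule.coe_smul, PiLp.smul_apply,
      smul_eq_mul] at hq hr ⊢
    have hconv := convex_Ioi (0 : ℝ) hq hr ha hb hab
    simp only [smul_eq_mul, Set.mem_Ioi] at hconv
    convert! hconv using 1
    linear_combination (y₀ k - x₀ k) * hab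
  calc
    _ ≤ dimH (Φ '' S) := dimH_mono ?_
    _ ≤ dimH S := hΦ.dimH_image_le hS subset_rfl
    _ ≤ dimH (Set.univ : Set ((V × W) × ({i // i ≠ k} → F))) := dimH_mono (Set.subset_univ _)
    _ = _ := by
      rw [Real.dimH_univ_eq_finrank, finrank_prod, finrank_prod, finrank_pi_fintype]
      simp [Fintype.card_subtype_compl]
  rintro a ⟨x, y, hx, hy, hlt, heq⟩
  refine ⟨((⟨x - x₀, hx⟩, ⟨y - y₀, hy⟩), fun i ↦ a i), by simpa [S, u] using hlt, ?_⟩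
  funext i
  by_cases h : i = k
  · subst h
    have hne : x i - y i ≠ 0 := (sub_pos.2 hlt).ne'
    have hsum : ∑ j, (x j - y j) • a j = p y - p x := by
      simp only [sub_smul, Finset.sum_sub_distrib]
      rw [sub_eq_sub_iff_add_eq_add, add_comm, heq]
    rw [Fintype.sum_eq_add_sum_subtype_ne _ i] at hsum
    simp only [Φ, u, ne_eq, not_true_eq_false, dite_false, add_sub_cancel, PiLp.sub_apply]
    rw [inv_smul_eq_iff₀ hne, ← hsum, add_sub_cancel_right]
  · simp [Φ, h]

theorem finrank_vectorSpan_finset_le {E : Type*} [AddCommGroup E] [Module ℝ E] {s : Finset E}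
    {d : ℕ} (hs : s.Nonempty) (hd : s.card ≤ d + 1) : finrank ℝ (vectorSpan ℝ (s : Set E)) ≤ d := by
  classical
  have hc : s.card = (s.card - 1) + 1 := (Nat.sub_add_cancel hs.card_pos).symm
  have h := finrank_vectorSpan_image_finset_le ℝ (id : E → E) s hc
  rw [Finset.image_id] at h
  omega

theorem Geometry.SimplicialComplex.isCompact_space {E : Type*} [AddCommGroup E] [Module ℝ E]
    [TopologicalSpace E] [IsTopologicalAddGroup E] [ContinuousSMul ℝ E]
    (K : Geometry.SimplicialComplex ℝ E) (hfin : K.faces.Finite) : IsCompact K.space :=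
  hfin.isCompact_biUnion fun s _ ↦ s.finite_toSet.isCompact_convexHull ℝ

/-- For a generic choice of coefficients, a linear perturbation of a `C¹` map is injective on
the underlying space of a `d`-dimensional complex, provided the target has dimension above `2d`. -/
theorem Geometry.SimplicialComplex.dense_setOf_injOn_linear_perturbation {ι F : Type*} [Fintype ι]
    [NormedAddCommGroup F] [NormedSpace ℝ F] [FiniteDimensional ℝ F]
    (K : Geometry.SimplicialComplex ℝ (EuclideanSpace ℝ ι)) (hfin : K.faces.Finite) {d : ℕ}
    (hdim : ∀ s ∈ K.faces, s.card ≤ d + 1) (hF : 2 * d < finrank ℝ F)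
    {p : EuclideanSpace ℝ ι → F} (hp : ContDiff ℝ 1 p) :
    Dense {a : ι → F | Set.InjOn (fun x : EuclideanSpace ℝ ι ↦ p x + ∑ i, x i • a i) K.space} := by
  classical
  rcases isEmpty_or_nonempty ι with hι | hι
  · convert! dense_univ
    exact Set.eq_univ_of_forall fun a ↦ Set.injOn_of_subsingleton _ _
  have : Finite K.faces := hfin
  let B (q : K.faces × K.faces × ι) : Set (ι → F) := {a | ∃ x y,
    x ∈ convexHull ℝ (q.1 : Set (EuclideanSpace ℝ ι)) ∧
    y ∈ convexHull ℝ (q.2.1 : Set (EuclideanSpace ℝ ι)) ∧ y q.2.2 < x q.2.2 ∧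
    p x + ∑ i, x i • a i = p y + ∑ i, y i • a i}
  let D := 2 * d + (Fintype.card ι - 1) * finrank ℝ F
  have hB (q) : dimH (B q) ≤ (D : ENNReal) := by
    obtain ⟨⟨s, hs⟩, ⟨t, ht⟩, k⟩ := q
    obtain ⟨x₀, hx₀⟩ := K.nonempty_of_mem_faces hs
    obtain ⟨y₀, hy₀⟩ := K.nonempty_of_mem_faces ht
    have hsub {s : Finset (EuclideanSpace ℝ ι)} {x x₀} (hx₀ : x₀ ∈ s)
        (hx : x ∈ convexHull ℝ (s : Set (EuclideanSpace ℝ ι))) :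
        x - x₀ ∈ vectorSpan ℝ (s : Set (EuclideanSpace ℝ ι)) := by
      rw [← direction_affineSpan, ← vsub_eq_sub]
      exact AffineSubspace.vsub_mem_direction (convexHull_subset_affineSpan _ hx)
        (subset_affineSpan ℝ _ hx₀)
    calc
      _ ≤ _ := dimH_mono ?_
      _ ≤ _ := dimH_setOf_linear_perturbation_eq_le hp
        (vectorSpan ℝ (s : Set (EuclideanSpace ℝ ι)))
        (vectorSpan ℝ (t : Set (EuclideanSpace ℝ ι))) x₀ y₀ k
      _ ≤ _ := ?_
    · rintro a ⟨x, y, hx, hy, h⟩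
      exact ⟨x, y, hsub hx₀ hx, hsub hy₀ hy, h⟩
    · have h₁ := finrank_vectorSpan_finset_le ⟨x₀, hx₀⟩ (hdim s hs)
      have h₂ := finrank_vectorSpan_finset_le ⟨y₀, hy₀⟩ (hdim t ht)
      exact Nat.cast_le.2 (by simp only [D]; omega)
  have hlt : dimH (⋃ q, B q) < finrank ℝ (ι → F) := by
    rw [dimH_iUnion]
    refine (iSup_le hB).trans_lt (Nat.cast_lt.2 ?_)
    obtain ⟨n, hn⟩ := Nat.exists_eq_succ_of_ne_zero (Fintype.card_ne_zero (α := ι))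
    simp only [D, finrank_pi_fintype, Finset.sum_const, Finset.card_univ, hn, smul_eq_mul,
      Nat.succ_eq_add_one, Nat.add_sub_cancel, add_mul, one_mul]
    omega
  refine (dense_compl_of_dimH_lt_finrank hlt).mono fun a ha ↦ ?_
  have hnot (x y : EuclideanSpace ℝ ι) (hx : x ∈ K.space) (hy : y ∈ K.space)
      (h : p x + ∑ i, x i • a i = p y + ∑ i, y i • a i) (k : ι) : x k ≤ y k := by
    by_contra! hk
    obtain ⟨s, hs, hxs⟩ := K.mem_space_iff.1 hx
    obtain ⟨t, ht, hyt⟩ := K.mem_space_iff.1 hy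
    exact ha (Set.mem_iUnion.2 ⟨(⟨s, hs⟩, ⟨t, ht⟩, k), x, y, hxs, hyt, hk, h⟩)
  intro x hx y hy h
  ext k
  exact le_antisymm (hnot x y hx hy h k) (hnot y x hy hx h.symm k)

/-- Let X be a compact subset of ℝ^N that is the underlying space of a finite
simplicial complex of dimension at most d. Let ε > 0 and f : X → ℝ^(2d+1) continuous.
Then there is a topological embedding g : X → ℝ^(2d+1) with ‖g x - f x‖ ≤ ε for all x. -/
theorem simplicial_approximation_by_embeddings
    (N d : ℕ) (K : Geometry.SimplicialComplex ℝ (EuclideanSpace ℝ (Fin N)))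
    (hfin : K.faces.Finite)
    (hdim : ∀ s ∈ K.faces, s.card ≤ d + 1)
    (ε : ℝ) (hε : 0 < ε)
    (f : K.space → EuclideanSpace ℝ (Fin (2 * d + 1)))
    (hf : Continuous f) :
    ∃ g : K.space → EuclideanSpace ℝ (Fin (2 * d + 1)),
      Topology.IsEmbedding g ∧ ∀ x : K.space, ‖g x - f x‖ ≤ ε := by
  have hK := K.isCompact_space hfin
  have : CompactSpace K.space := isCompact_iff_compactSpace.1 hK
  obtain ⟨f', hf'⟩ := ContinuousMap.exists_restrict_eq hK.isClosed ⟨f, hf⟩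
  obtain ⟨p, hp, hpf, -⟩ := f'.continuous.exists_contDiff_approx 1
    (continuous_const (y := ε / 2)) fun _ ↦ half_pos hε
  obtain ⟨R, hR₀, hR⟩ := hK.isBounded.exists_pos_norm_le
  have hδ : 0 < ε / 2 / (N * R + 1) := by positivity
  obtain ⟨a, hinj, ha⟩ := (K.dense_setOf_injOn_linear_perturbation hfin hdim (by simp)
    hp).exists_dist_lt 0 hδ
  rw [dist_zero_left] at ha
  refine ⟨fun x ↦ p x + ∑ i, (x : EuclideanSpace ℝ (Fin N)) i • a i, ?_, fun x ↦ ?_⟩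
  · refine (Continuous.isClosedEmbedding ?_ (Set.injOn_iff_injective.1 hinj)).isEmbedding
    have := hp.continuous
    fun_prop
  · have hfx : f' x = f x := DFunLike.congr_fun hf' x
    have hsum : ‖∑ i, (x : EuclideanSpace ℝ (Fin N)) i • a i‖ ≤ ε / 2 := calc
      _ ≤ ∑ _i : Fin N, R * (ε / 2 / (N * R + 1)) := by
        refine norm_sum_le_of_le _ fun i _ ↦ ?_
        rw [norm_smul]
        exact mul_le_mul ((PiLp.norm_apply_le _ i).trans (hR x x.2))
          ((norm_le_pi_norm a i).trans ha.le) (norm_nonneg _) hR₀.le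
      _ = (N * R) * (ε / 2 / (N * R + 1)) := by simp; ring
      _ ≤ (N * R + 1) * (ε / 2 / (N * R + 1)) := by gcongr; linarith
      _ = ε / 2 := by field_simp
    have hpx := hpf x
    rw [hfx, dist_eq_norm] at hpx
    rw [add_sub_right_comm]
    linarith [norm_add_le (p x - f x) (∑ i, (x : EuclideanSpace ℝ (Fin N)) i • a i)]
end

section
/- Let (X_n)_{n ≥ 0} be a sequence of topological spaces, each of which is the underlying space of a finite simplicial complex of dimension at most d in some Euclidean space, together with continuous maps p_n : X_{n+1} → X_n for all n ≥ 0. Then the inverse limit X := {(x_n) ∈ ∏_n X_n : p_n(x_{n+1}) = x_n for all n}, with the subspace topology from the product, is homeomorphic to a subspace of ℝ^(2d+1). -/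
open Set Topology

/-- The open star of the lattice point `v` in the Freudenthal triangulation of `ℝ^J`. -/
def latticeStar {J : Type*} (v : J → ℤ) : Set (J → ℝ) :=
  {y | (∀ j, |(v j : ℝ) - y j| < 1) ∧ ∀ j k, (v j : ℝ) - y j < 1 + (v k - y k)}

theorem isOpen_latticeStar {J : Type*} [Finite J] (v : J → ℤ) : IsOpen (latticeStar v) := by
  unfold latticeStar
  simp only [ofPred_and, ofPred_forall]
  refine IsOpen.inter (isOpen_iInter_of_finite fun j => ?_)
    (isOpen_iInter_of_finite fun j => isOpen_iInter_of_finite fun k => ?_)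
  · exact isOpen_lt (by fun_prop) (by fun_prop)
  · exact isOpen_lt (by fun_prop) (by fun_prop)

theorem floor_mem_latticeStar {J : Type*} (y : J → ℝ) : y ∈ latticeStar fun j => ⌊y j⌋ := by
  refine ⟨fun j => ?_, fun j k => ?_⟩
  · rw [abs_lt]
    constructor <;> linarith [Int.floor_le (y j), Int.lt_floor_add_one (y j)]
  · linarith [Int.floor_le (y j), Int.lt_floor_add_one (y k)]

/-- If the coordinates of `y` take at most `d` non-integral values, then `y` lies in at most
`d + 1` stars of lattice points. -/
theorem card_le_of_mem_latticeStar {J : Type*} [Fintype J] {y : J → ℝ} {c : J → ℕ} {d : ℕ}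
    (hc : ∀ j k, c j = c k → y j = y k)
    (hd : ∀ j, c j ∉ Finset.Icc 1 d → ∃ n : ℤ, y j = n)
    (s : Finset (J → ℤ)) (hs : ∀ v ∈ s, y ∈ latticeStar v) : s.card ≤ d + 1 := by
  classical
  let B : (J → ℤ) → Finset J := fun v => Finset.univ.filter fun j => y j < v j
  have hB : ∀ v j, j ∈ B v ↔ y j < v j := fun v j => by simp [B]
  have key : ∀ v ∈ s, ∀ w ∈ s, B v ⊆ B w →
      ((B v).image c).card = ((B w).image c).card → v = w := by
    intro v hv w hw hsub hcard
    have himg := Finset.eq_of_subset_of_card_le (Finset.image_subset_image hsub (f := c)) hcard.ge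
    obtain ⟨hv1, hv2⟩ := hs v hv
    obtain ⟨hw1, hw2⟩ := hs w hw
    have hsub' : B w ⊆ B v := by
      intro j hj
      have : c j ∈ (B v).image c := himg ▸ Finset.mem_image_of_mem c hj
      obtain ⟨k, hk, hkj⟩ := Finset.mem_image.1 this
      have hy := hc k j hkj
      rw [hB] at hk ⊢
      have h := hv2 k j
      have : (v k : ℝ) < v j + 1 := by linarith
      have : v k ≤ v j := Int.lt_add_one_iff.1 (by exact_mod_cast this)
      have : (v k : ℝ) ≤ v j := by exact_mod_cast this
      linarith
    funext j
    have h1 := abs_lt.1 (hv1 j)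
    have h2 := abs_lt.1 (hw1 j)
    have hiff : y j < v j ↔ y j < w j := by
      rw [← hB, ← hB]; exact ⟨fun h => hsub h, fun h => hsub' h⟩
    have h3 : (v j : ℝ) < w j + 1 ∧ (w j : ℝ) < v j + 1 := by
      by_cases h : y j < v j
      · have := hiff.1 h
        constructor <;> linarith
      · have := mt hiff.2 h
        constructor <;> linarith
    have h4 : v j < w j + 1 := by exact_mod_cast h3.1
    have h5 : w j < v j + 1 := by exact_mod_cast h3.2
    omega
  have chain : ∀ v ∈ s, ∀ w ∈ s, B v ⊆ B w ∨ B w ⊆ B v := by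
    intro v hv w hw
    by_contra! h
    obtain ⟨⟨j, hj, hj'⟩, ⟨k, hk, hk'⟩⟩ := And.imp Finset.not_subset.1 Finset.not_subset.1 h
    rw [hB] at hj hj' hk hk'
    obtain ⟨hv1, hv2⟩ := hs v hv
    obtain ⟨hw1, hw2⟩ := hs w hw
    have step : ∀ a b : ℤ, ∀ x : ℝ, x < a → ¬ x < b → (b : ℝ) ≤ a - 1 := by
      intro a b x h1 h2
      have : (b : ℝ) < a := by linarith
      have : b < a := by exact_mod_cast this
      have : b ≤ a - 1 := by omega
      exact_mod_cast this
    have h1 := step _ _ _ hj hj'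
    have h2 := step _ _ _ hk hk'
    linarith [hv2 j k, hw2 k j]
  calc s.card ≤ (Finset.range (d + 1)).card := by
        refine Finset.card_le_card_of_injOn (fun v => ((B v).image c).card) ?_ ?_
        · intro v hv
          have : (B v).image c ⊆ Finset.Icc 1 d := by
            intro n hn
            obtain ⟨j, hj, rfl⟩ := Finset.mem_image.1 hn
            by_contra hcj
            obtain ⟨n, hn⟩ := hd j hcj
            rw [hB, hn] at hj
            have h1 := (abs_lt.1 ((hs v hv).1 j)).2
            rw [hn] at h1
            have h2 : n < v j := by exact_mod_cast hj
            have h3 : (v j : ℝ) < n + 1 := by linarith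
            have h3 : v j < n + 1 := by exact_mod_cast h3
            omega
          have := Finset.card_le_card this
          simp at this ⊢
          omega
        · intro v hv w hw h
          rcases chain v hv w hw with h' | h'
          · exact key v hv w hw h' h
          · exact (key w hw v hv h' h.symm).symm
    _ = d + 1 := by simp

/-- The part of the standard simplex on the vertex set `ι` consisting of the points with at most
`d + 1` nonzero coordinates. -/
def stdSimplexSkeleton (ι : Type*) [Fintype ι] (d : ℕ) : Set (ι → ℝ) :=
  {w ∈ stdSimplex ℝ ι | (Function.support w).ncard ≤ d + 1}

/-- The partial sums of `w`, scaled by `m`. -/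
noncomputable def scaledPartialSum {r : ℕ} (m : ℕ) (w : Fin r → ℝ) (j : Fin (r + 1)) : ℝ :=
  m * ∑ i with i.castSucc < j, w i

theorem continuous_scaledPartialSum {r : ℕ} (m : ℕ) :
    Continuous (scaledPartialSum (r := r) m) := by
  unfold scaledPartialSum
  fun_prop

theorem scaledPartialSum_succ {r : ℕ} (m : ℕ) (w : Fin r → ℝ) (i : Fin r) :
    scaledPartialSum m w i.succ = scaledPartialSum m w i.castSucc + m * w i := by
  have : (Finset.univ.filter fun k : Fin r => k.castSucc < i.succ) =
      insert i (Finset.univ.filter fun k : Fin r => k.castSucc < i.castSucc) := by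
    ext k
    simp only [Finset.mem_filter, Finset.mem_univ, true_and, Finset.mem_insert, Fin.lt_def,
      Fin.ext_iff, Fin.val_succ, Fin.val_castSucc]
    omega
  unfold scaledPartialSum
  rw [this, Finset.sum_insert (by simp)]
  ring

/-- Fine open covers of order at most `d + 1` of the `d`-skeleton of the standard simplex on
`Fin r`, pulled back from the lattice stars along the partial sums. -/
theorem exists_cover_stdSimplexSkeleton_fin (r d : ℕ) {ε : ℝ} (hε : 0 < ε) :
    ∃ (ι : Type) (_ : Fintype ι) (U : ι → Set (Fin r → ℝ)), (∀ i, IsOpen (U i)) ∧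
      (stdSimplexSkeleton (Fin r) d ⊆ ⋃ i, U i) ∧
      (∀ i, ∀ x ∈ U i, ∀ y ∈ U i, dist x y < ε) ∧
      ∀ x ∈ stdSimplexSkeleton (Fin r) d, ∀ s : Finset ι, (∀ i ∈ s, x ∈ U i) →
        s.card ≤ d + 1 := by
  classical
  obtain ⟨m, hm⟩ := exists_nat_gt (4 / ε)
  have hm0 : (0 : ℝ) < m := lt_trans (by positivity) hm
  rw [div_lt_iff₀ hε] at hm
  let e : (Fin (r + 1) → Fin (m + 1)) → Fin (r + 1) → ℤ := fun v j => ((v j : ℕ) : ℤ)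
  have he : Function.Injective e := by
    intro v w h
    funext j
    have := congrFun h j
    simp only [e] at this
    exact Fin.ext (by exact_mod_cast this)
  refine ⟨Fin (r + 1) → Fin (m + 1), inferInstance,
    fun v => scaledPartialSum m ⁻¹' latticeStar (e v),
    fun v => (isOpen_latticeStar _).preimage (continuous_scaledPartialSum m), ?_, ?_, ?_⟩
  · rintro w ⟨⟨h0, h1⟩, -⟩
    have hn : ∀ j, 0 ≤ scaledPartialSum m w j := fun j =>
      mul_nonneg hm0.le (Finset.sum_nonneg fun i _ => h0 i)
    have hle : ∀ j, scaledPartialSum m w j ≤ m := fun j => by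
      have : ∑ i with i.castSucc < j, w i ≤ 1 :=
        h1 ▸ Finset.sum_le_sum_of_subset_of_nonneg (Finset.subset_univ _) fun i _ _ => h0 i
      unfold scaledPartialSum
      nlinarith
    have hfl : ∀ j, ⌊scaledPartialSum m w j⌋₊ < m + 1 := fun j =>
      Nat.lt_succ_of_le (Nat.floor_le_of_le (hle j))
    refine mem_iUnion.2 ⟨fun j => ⟨_, hfl j⟩, ?_⟩
    have : e (fun j => ⟨_, hfl j⟩) = fun j => ⌊scaledPartialSum m w j⌋ := by
      funext j
      exact Int.natCast_floor_eq_floor (hn j)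
    rw [mem_preimage, this]
    exact floor_mem_latticeStar _
  · intro v x hx y hy
    have hd : ∀ j, |scaledPartialSum m x j - scaledPartialSum m y j| < 2 := fun j => by
      have h1 := abs_lt.1 (hx.1 j)
      have h2 := abs_lt.1 (hy.1 j)
      rw [abs_lt]
      constructor <;> linarith
    rw [dist_pi_lt_iff hε]
    intro i
    have h1 := abs_lt.1 (hd i.succ)
    have h2 := abs_lt.1 (hd i.castSucc)
    rw [scaledPartialSum_succ, scaledPartialSum_succ] at h1
    rw [Real.dist_eq, abs_lt]
    constructor <;> nlinarith
  · rintro w ⟨⟨h0, h1⟩, hcard⟩ s hs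
    have hsupp : (Finset.univ.filter fun i => w i ≠ 0).card ≤ d + 1 := by
      rw [← Set.ncard_coe_finset]
      convert hcard
      ext; simp
    let S : Fin (r + 1) → Finset (Fin r) := fun j =>
      Finset.univ.filter fun i => w i ≠ 0 ∧ i.castSucc < j
    have hS : ∀ j, scaledPartialSum m w j = m * ∑ i ∈ S j, w i := by
      intro j
      unfold scaledPartialSum
      congr 1
      symm
      refine Finset.sum_subset (fun i => by simp [S]) fun i hi hi' => ?_
      simp [S] at hi hi'
      by_contra h
      exact absurd hi (not_lt.2 (hi' h))
    have hmono : ∀ j k, j ≤ k → S j ⊆ S k := by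
      intro j k hjk i
      simp only [S, Finset.mem_filter]
      exact fun h => ⟨h.1, h.2.1, h.2.2.trans_le hjk⟩
    have hcS : ∀ j k, (S j).card = (S k).card → S j = S k := by
      intro j k h
      rcases le_total j k with hjk | hjk
      · exact Finset.eq_of_subset_of_card_le (hmono _ _ hjk) h.ge
      · exact (Finset.eq_of_subset_of_card_le (hmono _ _ hjk) h.le).symm
    rw [← Finset.card_image_of_injective s he]
    refine card_le_of_mem_latticeStar (y := scaledPartialSum m w) (c := fun j => (S j).card)
      (fun j k h => by rw [hS, hS, hcS j k h]) (fun j hj => ?_) _ ?_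
    · have hsub : S j ⊆ Finset.univ.filter fun i => w i ≠ 0 := fun i => by
        simp only [S, Finset.mem_filter]; tauto
      rw [Finset.mem_Icc, not_and_or, not_le, not_le] at hj
      rcases hj with hj | hj
      · refine ⟨0, ?_⟩
        rw [hS, Finset.card_eq_zero.1 (Nat.lt_one_iff.1 hj)]
        simp
      · refine ⟨m, ?_⟩
        rw [hS, Finset.eq_of_subset_of_card_le hsub (by omega), Finset.sum_filter_ne_zero, h1]
        simp
    · intro v hv
      obtain ⟨u, hu, rfl⟩ := Finset.mem_image.1 hv
      exact hs u hu

/-- Points of a finite-dimensional space can be moved into general position by arbitrarily small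
perturbations. -/
theorem exists_dist_lt_affineIndependent {E : Type*} [NormedAddCommGroup E] [NormedSpace ℝ E]
    [FiniteDimensional ℝ E] (hE : 0 < Module.finrank ℝ E) {ι : Type*} [Fintype ι] (c : ι → E)
    {δ : ℝ} (hδ : 0 < δ) :
    ∃ z : ι → E, (∀ i, dist (z i) (c i) < δ) ∧
      ∀ s : Finset ι, s.card ≤ Module.finrank ℝ E + 1 → ∀ w : ι → ℝ, ∑ i ∈ s, w i = 0 →
        ∑ i ∈ s, w i • z i = 0 → ∀ i ∈ s, w i = 0 := by
  classical
  suffices H : ∀ t : Finset ι, ∃ z : ι → E, (∀ i, dist (z i) (c i) < δ) ∧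
      ∀ s ⊆ t, s.card ≤ Module.finrank ℝ E + 1 → ∀ w : ι → ℝ, ∑ i ∈ s, w i = 0 →
        ∑ i ∈ s, w i • z i = 0 → ∀ i ∈ s, w i = 0 by
    obtain ⟨z, hz, hz'⟩ := H Finset.univ
    exact ⟨z, hz, fun s => hz' s (Finset.subset_univ s)⟩
  intro t
  induction t using Finset.induction_on with
  | empty =>
    refine ⟨c, fun i => by simpa using hδ, fun s hs _ w _ _ i hi => ?_⟩
    exact absurd (hs hi) (Finset.notMem_empty i)
  | insert a t ha ih =>
    obtain ⟨z, hz, hz'⟩ := ih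
    obtain ⟨p, hp, hpA⟩ : ∃ p ∈ Metric.ball (c a) δ, ∀ s : Finset ι,
        s.card ≤ Module.finrank ℝ E → p ∉ affineSpan ℝ (z '' s) := by
      borelize E
      let μ : MeasureTheory.Measure E := MeasureTheory.Measure.addHaar
      have hnull : μ (⋃ s : {s : Finset ι // s.card ≤ Module.finrank ℝ E},
          (affineSpan ℝ (z '' (s : Finset ι)) : Set E)) = 0 := by
        refine MeasureTheory.measure_iUnion_null fun s => ?_
        refine MeasureTheory.Measure.addHaar_affineSubspace μ _ fun htop => ?_
        have hdir : vectorSpan ℝ (z '' (s : Finset ι)) = ⊤ := by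
          rw [← direction_affineSpan, htop, AffineSubspace.direction_top]
        obtain ⟨s, hs⟩ := s
        rcases Nat.eq_zero_or_eq_succ_pred s.card with h | h
        · rw [Finset.card_eq_zero] at h
          subst h
          have : Nontrivial E := Module.finrank_pos_iff.1 hE
          simp at hdir
        · have := finrank_vectorSpan_image_finset_le ℝ z s h
          rw [Finset.coe_image, hdir, finrank_top] at this
          simp only [Nat.succ_eq_add_one] at h
          omega
      have hpos : 0 < μ (Metric.ball (c a) δ) := Metric.measure_ball_pos μ _ hδ
      by_contra! h
      refine hpos.ne' (MeasureTheory.measure_mono_null (fun p hp => ?_) hnull)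
      obtain ⟨s, hs, hps⟩ := h p hp
      exact mem_iUnion.2 ⟨⟨s, hs⟩, hps⟩
    refine ⟨Function.update z a p, fun i => ?_, fun s hs hcard w hw hwz => ?_⟩
    · by_cases h : i = a
      · subst h; simpa using hp
      · simpa [h] using hz i
    have hupd : ∀ u : Finset ι, a ∉ u →
        ∑ i ∈ u, w i • Function.update z a p i = ∑ i ∈ u, w i • z i := fun u hu =>
      Finset.sum_congr rfl fun i hi => by
        rw [Function.update_of_ne (ne_of_mem_of_not_mem hi hu)]
    by_cases has : a ∈ s
    · have hsub : s.erase a ⊆ t := fun i hi =>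
        (Finset.mem_insert.1 (hs (Finset.mem_of_mem_erase hi))).resolve_left
          (Finset.ne_of_mem_erase hi)
      have hcard' := Finset.card_erase_of_mem has
      rw [← Finset.add_sum_erase s _ has] at hw hwz
      rw [hupd _ (Finset.notMem_erase a s), Function.update_self] at hwz
      have hwa : w a = 0 := by
        by_contra hwa
        refine hpA (s.erase a) (by omega) ?_
        have hsum : ∑ i ∈ s.erase a, (-(w a)⁻¹ * w i) = 1 := by
          rw [← Finset.mul_sum, eq_neg_of_add_eq_zero_right hw]
          field_simp
        have hpe : p = (s.erase a).affineCombination ℝ z fun i => -(w a)⁻¹ * w i := by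
          rw [Finset.affineCombination_eq_linear_combination _ _ _ hsum]
          simp only [mul_smul]
          rw [← Finset.smul_sum, eq_neg_of_add_eq_zero_right hwz, smul_neg, neg_smul, neg_neg,
            smul_smul, inv_mul_cancel₀ hwa, one_smul]
        have := affineCombination_mem_affineSpan_image (s := s.erase a) hsum
          (s' := ((s.erase a : Finset ι) : Set ι)) (fun i hi hi' => absurd hi hi') z
        rwa [← hpe] at this
      rw [hwa, zero_add] at hw
      rw [hwa, zero_smul, zero_add] at hwz
      intro i hi
      by_cases h : i = a
      · rw [h, hwa]
      · exact hz' _ hsub (by omega) w hw hwz i (Finset.mem_erase.2 ⟨h, hi⟩)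
    · rw [hupd s has] at hwz
      exact hz' s (fun i hi => (Finset.mem_insert.1 (hs hi)).resolve_left
        fun h => has (h ▸ hi)) hcard w hw hwz

/-- A compact metric space with arbitrarily fine finite open covers of order at most `d + 1` has a
topological embedding into every normed space of finite dimension at least `2 * d + 1`. -/
theorem exists_isEmbedding_of_exists_cover {X : Type*} [MetricSpace X] [CompactSpace X] {d : ℕ}
    (hX : ∀ ε > 0, ∃ (ι : Type) (_ : Fintype ι) (U : ι → Set X), (∀ i, IsOpen (U i)) ∧
      (⋃ i, U i) = univ ∧ (∀ i, ∀ x ∈ U i, ∀ y ∈ U i, dist x y < ε) ∧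
      ∀ x, ∀ s : Finset ι, (∀ i ∈ s, x ∈ U i) → s.card ≤ d + 1)
    {E : Type*} [NormedAddCommGroup E] [NormedSpace ℝ E] [FiniteDimensional ℝ E]
    (hE : 2 * d + 1 ≤ Module.finrank ℝ E) :
    ∃ f : X → E, IsEmbedding f := by
  classical
  let K : ℝ → Set (X × X) := fun ε => {q | ε ≤ dist q.1 q.2}
  have hK : ∀ ε, IsCompact (K ε) := fun ε =>
    (isClosed_le continuous_const (by fun_prop)).isCompact
  let W : ℕ → Set C(X, E) := fun n => {f | MapsTo (f.prodMap f) (K (1 / (n + 1))) (diagonal E)ᶜ}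
  have hWo : ∀ n, IsOpen (W n) := fun n =>
    (ContinuousMap.isOpen_setOfPred_mapsTo (hK _) isClosed_diagonal.isOpen_compl).preimage
      (ContinuousMap.continuous_of_continuous_uncurry (fun f : C(X, E) => f.prodMap f)
        (Continuous.prodMk (by fun_prop) (by fun_prop) :
          Continuous fun q : C(X, E) × X × X => (q.1 q.2.1, q.1 q.2.2)))
  have hWd : ∀ n, Dense (W n) := by
    intro n
    rw [Metric.dense_iff]
    intro f η hη
    have hε : (0 : ℝ) < 1 / (n + 1) := by positivity
    obtain ⟨δ, hδ, hfδ⟩ := Metric.uniformContinuous_iff.1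
      (CompactSpace.uniformContinuous_of_continuous f.continuous) (η / 4) (by positivity)
    obtain ⟨ι, _, U, hUo, hUc, hUd, hUcard⟩ := hX (min δ (1 / (n + 1))) (lt_min hδ hε)
    obtain ⟨φ, hφ⟩ := PartitionOfUnity.exists_isSubordinate isClosed_univ U hUo hUc.ge
    have hφU : ∀ i x, φ i x ≠ 0 → x ∈ U i := fun i x h => hφ i (subset_tsupport _ h)
    have hφ1 : ∀ x, ∑ i, φ i x = 1 := fun x => by
      rw [← finsum_eq_sum_of_fintype]; exact φ.sum_eq_one (mem_univ x)
    have hc : ∀ i, ∃ c : E, ∀ x ∈ U i, dist c (f x) < η / 4 := by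
      intro i
      rcases (U i).eq_empty_or_nonempty with h | ⟨x, hx⟩
      · exact ⟨0, fun x hx => by simp [h] at hx⟩
      · exact ⟨f x, fun y hy => hfδ ((hUd i x hx y hy).trans_le (min_le_left _ _))⟩
    choose c hc using hc
    obtain ⟨z, hzc, hz⟩ := exists_dist_lt_affineIndependent (E := E) (by omega) c
      (show 0 < η / 4 by positivity)
    let g : C(X, E) := ⟨fun x => ∑ i, φ i x • z i, by fun_prop⟩
    have hg : ∀ x, g x = ∑ i, φ i x • z i := fun x => rfl
    refine ⟨g, ?_, ?_⟩
    · rw [Metric.mem_ball]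
      refine lt_of_le_of_lt ((ContinuousMap.dist_le (by positivity)).2 fun x => ?_)
        (half_lt_self hη)
      have : g x - f x = ∑ i, φ i x • (z i - f x) := by
        simp only [smul_sub, Finset.sum_sub_distrib, ← Finset.sum_smul, hφ1, one_smul, hg]
      rw [dist_eq_norm, this]
      calc ‖∑ i, φ i x • (z i - f x)‖ ≤ ∑ i, φ i x * (η / 2) := by
            refine (norm_sum_le _ _).trans (Finset.sum_le_sum fun i _ => ?_)
            rw [norm_smul, Real.norm_of_nonneg (φ.nonneg i x)]
            by_cases h : φ i x = 0
            · simp [h]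
            · refine mul_le_mul_of_nonneg_left ?_ (φ.nonneg i x)
              rw [← dist_eq_norm]
              linarith [dist_triangle (z i) (c i) (f x), hzc i, hc i x (hφU i x h)]
        _ = η / 2 := by rw [← Finset.sum_mul, hφ1, one_mul]
    · rintro ⟨x, y⟩ hxy (hgxy : g x = g y)
      let S : X → Finset ι := fun x => Finset.univ.filter fun i => φ i x ≠ 0
      have hS : ∀ x, (S x).card ≤ d + 1 := fun x =>
        hUcard x _ fun i hi => hφU i x (Finset.mem_filter.1 hi).2
      have h0 : ∀ i ∉ S x ∪ S y, φ i x - φ i y = 0 := by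
        intro i hi
        simp only [S, Finset.mem_union, Finset.mem_filter, Finset.mem_univ, true_and, not_or,
          not_not] at hi
        rw [hi.1, hi.2, sub_zero]
      have hw := hz (S x ∪ S y) ((Finset.card_union_le _ _).trans (by linarith [hS x, hS y]))
        (fun i => φ i x - φ i y)
        (by
          rw [Finset.sum_subset (Finset.subset_univ _) fun i _ hi => h0 i hi,
            Finset.sum_sub_distrib, hφ1, hφ1, sub_self])
        (by
          rw [Finset.sum_subset (Finset.subset_univ _) fun i _ hi => by rw [h0 i hi, zero_smul]]
          simp only [sub_smul, Finset.sum_sub_distrib]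
          rw [← hg, ← hg, hgxy, sub_self])
      obtain ⟨i, hi⟩ : ∃ i, φ i x ≠ 0 := by
        by_contra! h
        simpa [h] using hφ1 x
      have hiy : φ i y ≠ 0 := by
        have := hw i (Finset.mem_union_left _ (by simp [S, hi]))
        rwa [← sub_eq_zero.1 this]
      have := (hUd i x (hφU i x hi) y (hφU i y hiy)).trans_le (min_le_right _ _)
      exact absurd (show 1 / ((n : ℝ) + 1) ≤ dist x y from hxy) (not_le.2 this)
  obtain ⟨f, hf⟩ := (dense_iInter_of_isOpen_nat hWo hWd).nonempty
  refine ⟨f, (f.continuous.isClosedEmbedding ?_).isEmbedding⟩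
  intro x y hxy
  by_contra hne
  obtain ⟨n, hn⟩ := exists_nat_one_div_lt (dist_pos.2 hne)
  exact mem_iInter.1 hf n (show (x, y) ∈ K _ from hn.le) hxy

/-- Fine open covers of order at most `d + 1` of the `d`-skeleton of the standard simplex. -/
theorem exists_cover_stdSimplexSkeleton (V : Type*) [Fintype V] (d : ℕ) {ε : ℝ} (hε : 0 < ε) :
    ∃ (ι : Type) (_ : Fintype ι) (U : ι → Set (V → ℝ)), (∀ i, IsOpen (U i)) ∧
      (stdSimplexSkeleton V d ⊆ ⋃ i, U i) ∧
      (∀ i, ∀ x ∈ U i, ∀ y ∈ U i, dist x y < ε) ∧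
      ∀ x ∈ stdSimplexSkeleton V d, ∀ s : Finset ι, (∀ i ∈ s, x ∈ U i) → s.card ≤ d + 1 := by
  obtain ⟨ι, hι, U, hUo, hUc, hUd, hUcard⟩ :=
    exists_cover_stdSimplexSkeleton_fin (Fintype.card V) d hε
  let e := (Fintype.equivFin V).symm
  have hmem : ∀ x ∈ stdSimplexSkeleton V d, x ∘ e ∈ stdSimplexSkeleton _ d := by
    rintro x ⟨⟨h0, h1⟩, h2⟩
    refine ⟨⟨fun i => h0 _, (e.sum_comp x).trans h1⟩, ?_⟩
    rwa [Function.support_comp_eq_preimage, ncard_preimage_of_injective_subset_range e.injective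
      (by simp)]
  refine ⟨ι, hι, fun i => (· ∘ e) ⁻¹' U i, fun i => (hUo i).preimage (by fun_prop), ?_, ?_, ?_⟩
  · intro x hx
    simpa using hUc (hmem x hx)
  · intro i x hx y hy
    rw [dist_pi_lt_iff hε]
    intro v
    simpa using (dist_pi_lt_iff hε).1 (hUd i _ hx _ hy) (e.symm v)
  · exact fun x hx s hs => hUcard _ (hmem x hx) s hs

theorem AffineIndependent.eq_of_sum_smul_eq {E : Type*} [AddCommGroup E] [Module ℝ E]
    {s : Finset E} (hs : AffineIndependent ℝ ((↑) : s → E)) {a b : E → ℝ}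
    (h1 : ∑ y ∈ s, a y = ∑ y ∈ s, b y) (h2 : ∑ y ∈ s, a y • y = ∑ y ∈ s, b y • y) :
    ∀ y ∈ s, a y = b y := by
  rw [affineIndependent_iff] at hs
  intro y hy
  have := hs Finset.univ (fun x => a x - b x) ?_ ?_ ⟨y, hy⟩ (Finset.mem_univ _)
  · exact sub_eq_zero.1 this
  · rw [Finset.sum_coe_sort s fun y => a y - b y, Finset.sum_sub_distrib, h1, sub_self]
  · rw [Finset.sum_coe_sort s fun y => (a y - b y) • y]
    simp only [sub_smul, Finset.sum_sub_distrib, h2, sub_self]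

/-- Barycentric coordinates embed a finite simplicial complex of dimension at most `d` in the
`d`-skeleton of a standard simplex. -/
theorem Geometry.SimplicialComplex.exists_isEmbedding_stdSimplexSkeleton {E : Type*}
    [NormedAddCommGroup E] [NormedSpace ℝ E] (K : Geometry.SimplicialComplex ℝ E) (hK : K.faces.Finite)
    {d : ℕ} (hd : ∀ s ∈ K.faces, s.card ≤ d + 1) :
    ∃ (V : Finset E) (q : K.space → V → ℝ), IsEmbedding q ∧ CompactSpace K.space ∧
      ∀ x, q x ∈ stdSimplexSkeleton V d := by
  classical
  let V : Finset E := hK.toFinset.sup id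
  have hV : ∀ s ∈ K.faces, s ⊆ V := fun s hs =>
    Finset.le_sup (f := id) (hK.mem_toFinset.2 hs)
  let ext : (V → ℝ) → E → ℝ := fun w y => if h : y ∈ V then w ⟨y, h⟩ else 0
  have hext : ∀ w (y : V), ext w y = w y := fun w y => by simp [ext]
  let T : Finset E → Set (V → ℝ) := fun s =>
    {w | w ∈ stdSimplex ℝ V ∧ ∀ y : V, (y : E) ∉ s → w y = 0}
  have hTc : ∀ s, IsCompact (T s) := fun s => by
    refine (isCompact_stdSimplex ℝ V).inter_right ?_
    change IsClosed {w : V → ℝ | ∀ y : V, (y : E) ∉ s → w y = 0}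
    simp only [ofPred_forall]
    exact isClosed_iInter fun y => isClosed_iInter fun _ =>
      isClosed_eq (by fun_prop) continuous_const
  let D : Set (V → ℝ) := ⋃ s ∈ K.faces, T s
  have hDc : IsCompact D := hK.isCompact_biUnion fun s _ => hTc s
  let G : (V → ℝ) → E := fun w => ∑ y, w y • (y : E)
  have hTsum : ∀ s ∈ K.faces, ∀ w ∈ T s,
      ∑ y ∈ s, ext w y = 1 ∧ ∑ y ∈ s, ext w y • y = G w := by
    rintro s hs w ⟨⟨h0, h1⟩, h2⟩
    have hz : ∀ y ∈ V, y ∉ s → ext w y = 0 := fun y hy hys => by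
      rw [hext w ⟨y, hy⟩]; exact h2 _ hys
    constructor
    · rw [Finset.sum_subset (hV s hs) hz, ← Finset.sum_coe_sort]
      simpa only [hext] using h1
    · rw [Finset.sum_subset (hV s hs) fun y hy hys => by rw [hz y hy hys, zero_smul],
        ← Finset.sum_coe_sort]
      simp only [hext, G]
  have hTnn : ∀ s, ∀ w ∈ T s, ∀ y, 0 ≤ ext w y := by
    rintro s w ⟨⟨h0, -⟩, -⟩ y
    simp only [ext]
    split_ifs
    exacts [h0 _, le_rfl]
  have hGmem : ∀ s ∈ K.faces, ∀ w ∈ T s, G w ∈ convexHull ℝ (s : Set E) := by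
    intro s hs w hw
    rw [Finset.mem_convexHull']
    exact ⟨ext w, fun y _ => hTnn s w hw y, hTsum s hs w hw⟩
  have hGsurj : ∀ s ∈ K.faces, ∀ x ∈ convexHull ℝ (s : Set E), ∃ w ∈ T s, G w = x := by
    intro s hs x hx
    obtain ⟨u, hu0, hu1, hux⟩ := Finset.mem_convexHull'.1 hx
    have hw : (fun y : V => if (y : E) ∈ s then u y else 0) ∈ T s := by
      refine ⟨⟨fun y => ?_, ?_⟩, fun y hy => if_neg hy⟩
      · dsimp only
        split_ifs with h
        exacts [hu0 _ h, le_rfl]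
      · rw [Finset.sum_coe_sort V fun y => if y ∈ s then u y else 0, Finset.sum_ite_mem,
          Finset.inter_eq_right.2 (hV s hs), hu1]
    refine ⟨_, hw, ?_⟩
    rw [← (hTsum s hs _ hw).2, ← hux]
    refine Finset.sum_congr rfl fun y hy => ?_
    have := hext (fun z : V => if (z : E) ∈ s then u z else 0) ⟨y, hV s hs hy⟩
    simp only [if_pos hy] at this
    rw [this]
  have huniq : ∀ s ∈ K.faces, ∀ w ∈ T s, ∀ w' ∈ T s, G w = G w' → w = w' := by
    intro s hs w hw w' hw' h
    have h1 := hTsum s hs w hw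
    have h2 := hTsum s hs w' hw'
    have := (K.indep hs).eq_of_sum_smul_eq (h1.1.trans h2.1.symm)
      (h1.2.trans (h.trans h2.2.symm))
    funext y
    by_cases hy : (y : E) ∈ s
    · simpa only [hext] using this y hy
    · rw [hw.2 y hy, hw'.2 y hy]
  have hGinj : InjOn G D := by
    intro w hw w' hw' h
    obtain ⟨s, hs, hws⟩ := mem_iUnion₂.1 hw
    obtain ⟨t, ht, hwt⟩ := mem_iUnion₂.1 hw'
    have hx := K.inter_subset_convexHull hs ht ⟨hGmem s hs w hws, h ▸ hGmem t ht w' hwt⟩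
    rw [← Finset.coe_inter] at hx
    have hst : s ∩ t ∈ K.faces := K.down_closed hs Finset.inter_subset_left (by
      rw [← Finset.coe_nonempty]; exact convexHull_nonempty_iff.1 ⟨_, hx⟩)
    obtain ⟨u, hu, hux⟩ := hGsurj _ hst _ hx
    have hus : u ∈ T s := ⟨hu.1, fun y hy => hu.2 y fun h => hy (Finset.inter_subset_left h)⟩
    have hut : u ∈ T t := ⟨hu.1, fun y hy => hu.2 y fun h => hy (Finset.inter_subset_right h)⟩
    exact (huniq s hs w hws u hus hux.symm).trans (huniq t ht u hut w' hwt (hux.trans h))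
  have hGD : ∀ w : D, G w ∈ K.space := by
    rintro ⟨w, hw⟩
    obtain ⟨s, hs, hws⟩ := mem_iUnion₂.1 hw
    exact K.convexHull_subset_space hs (hGmem s hs w hws)
  have : CompactSpace D := isCompact_iff_compactSpace.1 hDc
  let g : D ≃ K.space := Equiv.ofBijective (fun w => ⟨G w, hGD w⟩)
    ⟨fun w w' h => Subtype.ext (hGinj w.2 w'.2 (congrArg Subtype.val h)), by
      rintro ⟨x, hx⟩
      obtain ⟨s, hs, hxs⟩ := Geometry.SimplicialComplex.mem_space_iff.1 hx
      obtain ⟨w, hw, hwx⟩ := hGsurj s hs x hxs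
      exact ⟨⟨w, mem_iUnion₂.2 ⟨s, hs, hw⟩⟩, Subtype.ext hwx⟩⟩
  have hg : Continuous g := Continuous.subtype_mk (by fun_prop) _
  let e : D ≃ₜ K.space := hg.homeoOfEquivCompactToT2
  refine ⟨V, fun x => (e.symm x : V → ℝ), IsEmbedding.subtypeVal.comp e.symm.isEmbedding,
    e.compactSpace, fun x => ?_⟩
  obtain ⟨s, hs, hws⟩ := mem_iUnion₂.1 (e.symm x).2
  refine ⟨hws.1, ?_⟩
  calc (Function.support (e.symm x : V → ℝ)).ncard
      ≤ (Subtype.val ⁻¹' (s : Set E) : Set V).ncard := by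
        refine ncard_le_ncard (fun y hy => ?_) (toFinite _)
        by_contra h
        exact hy (hws.2 y h)
    _ = (s : Set E).ncard := ncard_preimage_of_injective_subset_range Subtype.val_injective
        (by simpa using hV s hs)
    _ ≤ d + 1 := by rw [ncard_coe_finset]; exact hd s hs

/-- In a compact inverse limit, points with sufficiently close images at a sufficiently late stage
are close. -/
theorem exists_dist_lt_of_dist_lt {X : Type*} [MetricSpace X] [CompactSpace X] {Y : ℕ → Type*}
    [∀ n, MetricSpace (Y n)] {q : ∀ n, X → Y n} (hq : ∀ n, Continuous (q n))
    (hmono : ∀ n x y, q (n + 1) x = q (n + 1) y → q n x = q n y)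
    (hsep : ∀ x y, (∀ n, q n x = q n y) → x = y) {ε : ℝ} (hε : 0 < ε) :
    ∃ n, ∃ δ > 0, ∀ x y, dist (q n x) (q n y) < δ → dist x y < ε := by
  let K : Set (X × X) := {z | ε ≤ dist z.1 z.2}
  have hK : IsCompact K := (isClosed_le continuous_const (by fun_prop)).isCompact
  let F : ℕ → Set (X × X) := fun n => K ∩ {z | q n z.1 = q n z.2}
  have hFc : ∀ n, IsClosed (F n) := fun n =>
    hK.isClosed.inter (isClosed_eq ((hq n).comp continuous_fst) ((hq n).comp continuous_snd))
  obtain ⟨n, hn⟩ : ∃ n, F n = ∅ := by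
    by_contra! h
    obtain ⟨z, hz⟩ := IsCompact.nonempty_iInter_of_sequence_nonempty_isCompact_isClosed F
      (fun n z hz => ⟨hz.1, hmono n _ _ hz.2⟩) h (hFc 0).isCompact hFc
    rw [mem_iInter] at hz
    have h1 := hsep z.1 z.2 fun n => (hz n).2
    have h2 : ε ≤ dist z.1 z.2 := (hz 0).1
    rw [h1, dist_self] at h2
    linarith
  refine ⟨n, ?_⟩
  rcases K.eq_empty_or_nonempty with hKe | hKn
  · refine ⟨1, one_pos, fun x y _ => ?_⟩
    by_contra! h
    exact hKe.subset (show (x, y) ∈ K from h)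
  · obtain ⟨z, hz, hmin⟩ := hK.exists_isMinOn hKn
      (f := fun z => dist (q n z.1) (q n z.2))
      (((hq n).comp continuous_fst).dist ((hq n).comp continuous_snd)).continuousOn
    refine ⟨dist (q n z.1) (q n z.2), dist_pos.2 fun h => hn.subset ⟨hz, h⟩, fun x y h => ?_⟩
    by_contra! h'
    exact absurd (hmin (show (x, y) ∈ K from h')) (not_le.2 h)

/-- An inverse limit of a sequence of (underlying spaces of) finite simplicial
complexes of dimension at most d, along continuous bonding maps, is homeomorphic to a
subspace of ℝ^(2d+1). -/
theorem inverseLimit_of_finite_simplicial_complexes_embeds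
    (d : ℕ) (X : ℕ → Type) [∀ n, TopologicalSpace (X n)]
    (hX : ∀ n, ∃ (N : ℕ) (K : Geometry.SimplicialComplex ℝ (EuclideanSpace ℝ (Fin N))),
        K.faces.Finite ∧ (∀ s ∈ K.faces, s.card ≤ d + 1) ∧ Nonempty (X n ≃ₜ K.space))
    (p : ∀ n : ℕ, X (n + 1) → X n) (hp : ∀ n, Continuous (p n)) :
    ∃ s : Set (EuclideanSpace ℝ (Fin (2 * d + 1))),
      Nonempty ({x : ∀ n, X n // ∀ n, p n (x (n + 1)) = x n} ≃ₜ s) := by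
  have hcoord : ∀ n, ∃ (V : Type) (_ : Fintype V) (q : X n → V → ℝ), IsEmbedding q ∧
      CompactSpace (X n) ∧ ∀ x, q x ∈ stdSimplexSkeleton V d := by
    intro n
    obtain ⟨N, K, hK, hd, ⟨e⟩⟩ := hX n
    obtain ⟨V, q, hq, hc, hqd⟩ := K.exists_isEmbedding_stdSimplexSkeleton hK hd
    exact ⟨V, inferInstance, q ∘ e, hq.comp e.isEmbedding, e.symm.compactSpace, fun x => hqd _⟩
  choose V hV q hq hc hqd using hcoord
  have ht2 : ∀ n, T2Space (X n) := fun n => (hq n).t2Space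
  have hsc : ∀ n, SecondCountableTopology (X n) := fun n => (hq n).secondCountableTopology
  have : CompactSpace {x : ∀ n, X n // ∀ n, p n (x (n + 1)) = x n} := by
    refine isCompact_iff_compactSpace.1 (IsClosed.isCompact ?_)
    change IsClosed {x : ∀ n, X n | ∀ n, p n (x (n + 1)) = x n}
    simp only [ofPred_forall]
    exact isClosed_iInter fun n =>
      isClosed_eq ((hp n).comp (continuous_apply _)) (continuous_apply n)
  have : SecondCountableTopology {x : ∀ n, X n // ∀ n, p n (x (n + 1)) = x n} :=
    IsEmbedding.subtypeVal.secondCountableTopology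
  have := TopologicalSpace.metrizableSpace_of_t3_secondCountable
    {x : ∀ n, X n // ∀ n, p n (x (n + 1)) = x n}
  let := TopologicalSpace.metrizableSpaceMetric {x : ∀ n, X n // ∀ n, p n (x (n + 1)) = x n}
  have hπ : ∀ n, Continuous fun x : {x : ∀ n, X n // ∀ n, p n (x (n + 1)) = x n} =>
      q n (x.1 n) := fun n =>
    (hq n).continuous.comp ((continuous_apply n).comp continuous_subtype_val)
  obtain ⟨f, hf⟩ : ∃ f : {x : ∀ n, X n // ∀ n, p n (x (n + 1)) = x n} →
      EuclideanSpace ℝ (Fin (2 * d + 1)), IsEmbedding f := by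
    refine exists_isEmbedding_of_exists_cover (d := d) (fun ε hε => ?_) (by simp)
    obtain ⟨n, δ, hδ, hn⟩ := exists_dist_lt_of_dist_lt hπ
      (fun n x y h => by rw [← x.2 n, ← y.2 n, (hq (n + 1)).injective h])
      (fun x y h => Subtype.ext (funext fun n => (hq n).injective (h n))) hε
    obtain ⟨ι, hι, U, hUo, hUc, hUd, hUcard⟩ := exists_cover_stdSimplexSkeleton (V n) d hδ
    refine ⟨ι, hι, fun i => (fun x => q n (x.1 n)) ⁻¹' U i, fun i => (hUo i).preimage (hπ n),
      ?_, fun i x hx y hy => hn x y (hUd i _ hx _ hy), fun x s hs => hUcard _ (hqd n _) s hs⟩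
    rw [← preimage_iUnion, eq_univ_iff_forall]
    exact fun x => hUc (hqd n _)
  exact ⟨range f, ⟨hf.toHomeomorph⟩⟩
end

section
/- Let W be a dendrite whose branch points are dense in W and such that for every branch point x of W, the complement W ∖ {x} has countably infinitely many connected components, and let w be a branch point of W. Then for every dendrite X and every point P ∈ X there exists a topological embedding f : X → W with f(P) = w. -/
open Topology

/-- A continuum: a nonempty compact connected metrizable topological space. -/
def IsContinuum (X : Type*) [TopologicalSpace X] : Prop :=
  Nonempty X ∧ CompactSpace X ∧ ConnectedSpace X ∧ TopologicalSpace.MetrizableSpace X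

/-- A simple closed curve in `X`: a subspace homeomorphic to the circle. -/
def IsSimpleClosedCurve {X : Type*} [TopologicalSpace X] (S : Set X) : Prop :=
  Nonempty (S ≃ₜ AddCircle (1 : ℝ))

/-- A dendrite: a locally connected continuum containing no simple closed curve. -/
def IsDendrite (X : Type*) [TopologicalSpace X] : Prop :=
  IsContinuum X ∧ LocallyConnectedSpace X ∧ ∀ S : Set X, ¬ IsSimpleClosedCurve S

/-- A local dendrite: a continuum each of whose points has a neighborhood
that is a dendrite. -/
def IsLocalDendrite (X : Type*) [TopologicalSpace X] : Prop :=
  IsContinuum X ∧ ∀ x : X, ∃ N : Set X, N ∈ 𝓝 x ∧ IsDendrite N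

/-- A branch point of `X`: a point whose complement has at least three
connected components. -/
def IsBranchPoint {X : Type*} [TopologicalSpace X] (x : X) : Prop :=
  ∃ u v w : ConnectedComponents (↥({x}ᶜ : Set X)), u ≠ v ∧ u ≠ w ∧ v ≠ w

/-- `X ∖ {x}` has countably infinitely many connected components
(i.e. there are ℵ₀ branches at `x`). -/
def HasAlephNullBranchesAt (X : Type*) [TopologicalSpace X] (x : X) : Prop :=
  Countable (ConnectedComponents (↥({x}ᶜ : Set X))) ∧
    Infinite (ConnectedComponents (↥({x}ᶜ : Set X)))

open Set Filter

section Paths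

variable {Z : Type*} [MetricSpace Z]

/-- `x` and `y` lie in a common preconnected open set of diameter at most `ε`. -/
def SmallJoined (ε : ℝ) (x y : Z) : Prop :=
  ∃ U : Set Z, IsOpen U ∧ IsPreconnected U ∧ x ∈ U ∧ y ∈ U ∧ ∀ p ∈ U, ∀ q ∈ U, dist p q ≤ ε

/-- Along `g`, restricted to `[s, t]`, nearby parameters have `ε`-joined values. -/
def SmallJumpsOn (ε : ℝ) (g : ℝ → Z) (s t : ℝ) : Prop :=
  ∀ u, ∀ᶠ v in 𝓝[Icc s t] u, u ∈ Icc s t → SmallJoined ε (g u) (g v)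

lemma SmallJoined.dist_le {ε : ℝ} {x y : Z} (h : SmallJoined ε x y) : dist x y ≤ ε := by
  obtain ⟨U, -, -, hx, hy, h⟩ := h
  exact h _ hx _ hy

lemma SmallJoined.symm {ε : ℝ} {x y : Z} (h : SmallJoined ε x y) : SmallJoined ε y x := by
  obtain ⟨U, h1, h2, hx, hy, h⟩ := h
  exact ⟨U, h1, h2, hy, hx, h⟩

lemma exists_open_preconnected_small [LocallyConnectedSpace Z] {ε : ℝ} (hε : 0 < ε) (x : Z)
    {U : Set Z} (hU : IsOpen U) (hx : x ∈ U) :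
    ∃ V ⊆ U, IsOpen V ∧ IsPreconnected V ∧ x ∈ V ∧ ∀ p ∈ V, ∀ q ∈ V, dist p q ≤ ε := by
  obtain ⟨V, hVsub, hVo, hxV, hVc⟩ := locallyConnectedSpace_iff_subsets_isOpen_isConnected.1
    ‹_› x (U ∩ Metric.ball x (ε / 2))
    ((hU.inter Metric.isOpen_ball).mem_nhds ⟨hx, Metric.mem_ball_self (half_pos hε)⟩)
  refine ⟨V, fun p hp => (hVsub hp).1, hVo, hVc.isPreconnected, hxV, fun p hp q hq => ?_⟩
  have h1 := Metric.mem_ball.1 (hVsub hp).2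
  have h2 := Metric.mem_ball'.1 (hVsub hq).2
  linarith [dist_triangle p x q]

lemma SmallJumpsOn.glue {ε : ℝ} {g h : ℝ → Z} {s m t : ℝ} (hsm : s ≤ m) (hmt : m ≤ t)
    (hg : SmallJumpsOn ε g s m) (hh : SmallJumpsOn ε h m t) (hm : g m = h m) :
    SmallJumpsOn ε (fun u => if u ≤ m then g u else h u) s t := by
  intro u
  have hk : ∀ v ∈ Icc m t, (if v ≤ m then g v else h v) = h v := by
    intro v hv
    split_ifs with h1
    · rw [le_antisymm h1 hv.1, hm]
    · rfl
  rw [← Icc_union_Icc_eq_Icc hsm hmt, nhdsWithin_union, eventually_sup]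
  constructor
  · by_cases hu : u ∈ Icc s m
    · filter_upwards [hg u, self_mem_nhdsWithin] with v hv hv' _
      simpa [hu.2, hv'.2] using hv hu
    · have : 𝓝[Icc s m] u = ⊥ := by
        rw [← notMem_closure_iff_nhdsWithin_eq_bot, isClosed_Icc.closure_eq]; exact hu
      simp [this]
  · by_cases hu : u ∈ Icc m t
    · filter_upwards [hh u, self_mem_nhdsWithin] with v hv hv' _
      simp only [hk u hu, hk v hv']
      exact hv hu
    · have : 𝓝[Icc m t] u = ⊥ := by
        rw [← notMem_closure_iff_nhdsWithin_eq_bot, isClosed_Icc.closure_eq]; exact hu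
      simp [this]

lemma exists_smallJumpsOn_of_isPreconnected [LocallyConnectedSpace Z] {δ : ℝ} (hδ : 0 < δ)
    {U : Set Z} (hU : IsOpen U) (hUc : IsPreconnected U) {x y : Z} (hx : x ∈ U) (hy : y ∈ U)
    {s t : ℝ} (hst : s < t) :
    ∃ g : ℝ → Z, g s = x ∧ g t = y ∧ SmallJumpsOn δ g s t ∧ ∀ u, g u ∈ U := by
  have key := hUc.induction₂' (fun p q => ∀ s t : ℝ, s < t → ∃ g : ℝ → Z, g s = p ∧ g t = q ∧
    SmallJumpsOn δ g s t ∧ ∀ u, g u ∈ U) ?_ ?_ hx hy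
  · exact key s t hst
  · intro p hp
    obtain ⟨V, hVU, hVo, hVc, hpV, hV⟩ := exists_open_preconnected_small hδ p hU hp
    have step : ∀ a ∈ V, ∀ b ∈ V, ∀ s t : ℝ, s < t → ∃ g : ℝ → Z, g s = a ∧ g t = b ∧
        SmallJumpsOn δ g s t ∧ ∀ u, g u ∈ U := by
      intro a ha b hb s t hst
      have hmem : ∀ u, (if u < t then a else b) ∈ V := by intro u; split_ifs <;> assumption
      refine ⟨fun u => if u < t then a else b, by simp [hst], by simp, fun u => ?_,
        fun u => hVU (hmem u)⟩
      exact Eventually.of_forall fun v _ => ⟨V, hVo, hVc, hmem u, hmem v, hV⟩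
    filter_upwards [mem_nhdsWithin_of_mem_nhds (hVo.mem_nhds hpV)] with q hq
    exact ⟨step p hpV q hq, step q hq p hpV⟩
  · intro p q r _ _ _ hpq hqr s t hst
    obtain ⟨g, g1, g2, g3, g4⟩ := hpq s ((s + t) / 2) (by linarith)
    obtain ⟨h, h1, h2, h3, h4⟩ := hqr ((s + t) / 2) t (by linarith)
    refine ⟨_, ?_, ?_, g3.glue (by linarith) (by linarith) h3 (g2.trans h1.symm), fun u => ?_⟩
    · rw [if_pos (by linarith), g1]
    · rw [if_neg (by linarith), h2]
    · split_ifs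
      exacts [g4 u, h4 u]

lemma SmallJumpsOn.exists_refinement [LocallyConnectedSpace Z] {ε δ : ℝ} (hδ : 0 < δ)
    {g : ℝ → Z} (hg : SmallJumpsOn ε g 0 1) :
    ∃ h : ℝ → Z, h 0 = g 0 ∧ h 1 = g 1 ∧ SmallJumpsOn δ h 0 1 ∧
      ∀ u ∈ Icc (0 : ℝ) 1, dist (g u) (h u) ≤ 2 * ε := by
  let Good : ℝ → ℝ → Prop := fun s t => ∃ h : ℝ → Z, h s = g s ∧ h t = g t ∧
    SmallJumpsOn δ h s t ∧ ∀ u ∈ Icc s t, dist (g u) (h u) ≤ 2 * ε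
  have glue : ∀ s m t, s ≤ m → m ≤ t → Good s m → Good m t → Good s t := by
    rintro s m t hsm hmt ⟨h, a1, a2, a3, a4⟩ ⟨k, b1, b2, b3, b4⟩
    refine ⟨_, ?_, ?_, a3.glue hsm hmt b3 (a2.trans b1.symm), fun u hu => ?_⟩
    · simp only [if_pos hsm, a1]
    · split_ifs with h1
      · rw [le_antisymm h1 hmt, a2]
      · exact b2
    · split_ifs with h1
      · exact a4 u ⟨hu.1, h1⟩
      · exact b4 u ⟨(not_le.1 h1).le, hu.2⟩
  have hε : 0 ≤ ε := by
    have h0 : (0 : ℝ) ∈ Icc (0 : ℝ) 1 := by simp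
    simpa using ((hg 0).self_of_nhdsWithin h0 h0).dist_le
  have refl : ∀ s, Good s s := by
    intro s
    refine ⟨fun _ => g s, rfl, rfl, fun u => ?_, fun u hu => ?_⟩
    · obtain ⟨V, -, hVo, hVc, hpV, hV⟩ :=
        exists_open_preconnected_small hδ (g s) isOpen_univ (mem_univ _)
      exact Eventually.of_forall fun v _ => ⟨V, hVo, hVc, hpV, hpV, hV⟩
    · obtain rfl : u = s := le_antisymm hu.2 hu.1
      simpa using hε
  have joined : ∀ p q : ℝ, ∀ c : Z, SmallJoined ε (g p) c → SmallJoined ε c (g q) → p < q →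
      (∀ u ∈ Icc p q, dist c (g u) ≤ ε) → Good p q := by
    rintro p q c ⟨U, hUo, hUc, hpU, hcU, hU⟩ ⟨V, hVo, hVc, hcV, hqV, hV⟩ hpq hu
    obtain ⟨h, a1, a2, a3, a4⟩ := exists_smallJumpsOn_of_isPreconnected hδ hUo hUc hpU hcU
      (show p < (p + q) / 2 by linarith)
    obtain ⟨k, b1, b2, b3, b4⟩ := exists_smallJumpsOn_of_isPreconnected hδ hVo hVc hcV hqV
      (show (p + q) / 2 < q by linarith)
    refine ⟨_, ?_, ?_, a3.glue (by linarith) (by linarith) b3 (a2.trans b1.symm),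
      fun u hu' => ?_⟩
    · rw [if_pos (by linarith), a1]
    · rw [if_neg (by linarith), b2]
    · have h1 := hu u hu'
      rw [dist_comm] at h1
      split_ifs
      · linarith [dist_triangle (g u) c (h u), hU c hcU _ (a4 u)]
      · linarith [dist_triangle (g u) c (k u), hV c hcV _ (b4 u)]
  have nhd : ∀ u : Icc (0 : ℝ) 1, ∃ O : Set (Icc (0 : ℝ) 1), IsOpen O ∧ u ∈ O ∧
      ∀ v ∈ O, SmallJoined ε (g u) (g v) := by
    intro u
    have h1 := hg u
    rw [← eventually_nhds_subtype_iff (Icc (0 : ℝ) 1) u (fun v => (u : ℝ) ∈ Icc (0 : ℝ) 1 → SmallJoined ε (g u) (g v))] at h1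
    obtain ⟨O, hO, hOo, huO⟩ := eventually_nhds_iff.1 h1
    exact ⟨O, hOo, huO, fun v hv => hO v hv u.2⟩
  choose O hOo huO hO using nhd
  obtain ⟨τ, h0, hmono, ⟨m, hm⟩, hτ⟩ := exists_monotone_Icc_subset_open_cover_Icc zero_le_one hOo
    (fun u _ => mem_iUnion.2 ⟨u, huO u⟩)
  have all : ∀ n, Good 0 (τ n) := by
    intro n
    induction n with
    | zero => rw [h0]; exact refl 0
    | succ n ih =>
      refine glue _ _ _ (τ n).2.1 (hmono n.le_succ) ih ?_
      rcases (hmono n.le_succ).eq_or_lt with h | h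
      · rw [← h]; exact refl _
      obtain ⟨i, hi⟩ := hτ n
      refine joined _ _ (g i) (hO i _ (hi ⟨le_rfl, h.le⟩)).symm (hO i _ (hi ⟨h.le, le_rfl⟩)) h ?_
      intro u hu
      exact (hO i ⟨u, (τ n).2.1.trans hu.1, hu.2.trans (τ (n+1)).2.2⟩ (hi hu)).dist_le
  have := all m
  rwa [hm m le_rfl] at this

lemma exists_continuousOn_joining [LocallyConnectedSpace Z] [PreconnectedSpace Z]
    [CompleteSpace Z] (x y : Z) :
    ∃ f : ℝ → Z, ContinuousOn f (Icc 0 1) ∧ f 0 = x ∧ f 1 = y := by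
  let ε : ℕ → ℝ := fun n => 1 / 2 / 2 ^ n
  have hε : ∀ n, 0 < ε n := fun n => by positivity
  obtain ⟨g₀, g0, g1, gs, -⟩ := exists_smallJumpsOn_of_isPreconnected (hε 0) isOpen_univ
    isPreconnected_univ (mem_univ x) (mem_univ y) zero_lt_one
  have step : ∀ n (g : ℝ → Z), ∃ h : ℝ → Z, SmallJumpsOn (ε n) g 0 1 →
      h 0 = g 0 ∧ h 1 = g 1 ∧ SmallJumpsOn (ε (n + 1)) h 0 1 ∧
        ∀ u ∈ Icc (0 : ℝ) 1, dist (g u) (h u) ≤ 2 * ε n := by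
    intro n g
    by_cases hg : SmallJumpsOn (ε n) g 0 1
    · obtain ⟨h, hh⟩ := hg.exists_refinement (hε (n + 1))
      exact ⟨h, fun _ => hh⟩
    · exact ⟨g, fun h => absurd h hg⟩
  choose next hnext using step
  let G : ℕ → ℝ → Z := fun n => Nat.rec g₀ next n
  have hG : ∀ n, SmallJumpsOn (ε n) (G n) 0 1 := by
    intro n
    induction n with
    | zero => exact gs
    | succ n ih => exact (hnext n (G n) ih).2.2.1
  have hGd : ∀ u ∈ Icc (0 : ℝ) 1, ∀ n, dist (G n u) (G (n + 1) u) ≤ 2 / 2 / 2 ^ n := by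
    intro u hu n
    refine ((hnext n (G n) (hG n)).2.2.2 u hu).trans (le_of_eq ?_)
    simp only [ε]; ring
  have hG0 : ∀ n, G n 0 = x := by
    intro n
    induction n with
    | zero => exact g0
    | succ n ih => exact (hnext n (G n) (hG n)).1.trans ih
  have hG1 : ∀ n, G n 1 = y := by
    intro n
    induction n with
    | zero => exact g1
    | succ n ih => exact (hnext n (G n) (hG n)).2.1.trans ih
  have lim : ∀ u, ∃ z, u ∈ Icc (0 : ℝ) 1 → Tendsto (fun n => G n u) atTop (𝓝 z) := by
    intro u
    by_cases hu : u ∈ Icc (0 : ℝ) 1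
    · obtain ⟨z, hz⟩ := cauchySeq_tendsto_of_complete (cauchySeq_of_le_geometric_two (hGd u hu))
      exact ⟨z, fun _ => hz⟩
    · exact ⟨x, fun h => absurd h hu⟩
  choose f hf using lim
  have hfd : ∀ u ∈ Icc (0 : ℝ) 1, ∀ n, dist (G n u) (f u) ≤ 2 / 2 ^ n := fun u hu n =>
    dist_le_of_le_geometric_two_of_tendsto (hGd u hu) (hf u hu) n
  have i0 : (0 : ℝ) ∈ Icc (0 : ℝ) 1 := by simp
  have i1 : (1 : ℝ) ∈ Icc (0 : ℝ) 1 := by simp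
  refine ⟨f, fun u hu => ?_, tendsto_nhds_unique (hf 0 i0) (by simp [hG0]),
    tendsto_nhds_unique (hf 1 i1) (by simp [hG1])⟩
  rw [ContinuousWithinAt, Metric.tendsto_nhds]
  intro r hr
  obtain ⟨n, hn⟩ : ∃ n : ℕ, 5 / 2 ^ n < r := by
    obtain ⟨n, hn⟩ := exists_pow_lt_of_lt_one (show 0 < r / 5 by positivity)
      (show (1 / 2 : ℝ) < 1 by norm_num)
    refine ⟨n, ?_⟩
    rw [div_pow, one_pow] at hn
    rw [div_eq_mul_one_div]
    linarith
  filter_upwards [hG n u, self_mem_nhdsWithin] with v hv hv'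
  have h1 := (hv hu).dist_le
  have h2 := hfd u hu n
  have h3 := hfd v hv' n
  have h4 : ε n ≤ 1 / 2 ^ n := by
    simp only [ε]; gcongr; norm_num
  rw [dist_comm] at h1 h3
  have h5 := dist_triangle (f v) (G n v) (f u)
  have h6 := dist_triangle (G n v) (G n u) (f u)
  have h7 : (5 : ℝ) / 2 ^ n = 2 / 2 ^ n + 1 / 2 ^ n + 2 / 2 ^ n := by ring
  linarith

end Paths

section Parametrization

/-- An order-theoretic parametrization of an ordered continuum by `[0, 1]`, matching prescribed
countable dense sets. -/
lemma exists_continuous_strictMono_onto_Icc {K : Type*} [LinearOrder K] [TopologicalSpace K]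
    [CompactSpace K] [ClosedIciTopology K] [ClosedIicTopology K] [DenselyOrdered K] {a b : K}
    (ha : ∀ x, a ≤ x) (hb : ∀ x, x ≤ b) (hab : a < b) {D : Set K} (hDc : D.Countable)
    (hD : Dense D) {E : Set ℝ} (hE : E ⊆ Ioo 0 1) (hEc : E.Countable)
    (hEd : ∀ s t : ℝ, 0 ≤ s → s < t → t ≤ 1 → ∃ e ∈ E, s < e ∧ e < t) :
    ∃ ψ : K → ℝ, Continuous ψ ∧ StrictMono ψ ∧ ψ a = 0 ∧ ψ b = 1 ∧ range ψ = Icc 0 1 ∧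
      ∀ d ∈ D, d ≠ a → d ≠ b → ψ d ∈ E := by
  let D' : Set K := {d | d ∈ D ∧ a < d ∧ d < b}
  have hDd : ∀ x y : K, x < y → ∃ d ∈ D', x < d ∧ d < y := by
    intro x y hxy
    obtain ⟨d, hd, hdD⟩ := hD.inter_open_nonempty (Ioo x y) (isOpen_Ioi.inter isOpen_Iio)
      (exists_between hxy)
    exact ⟨d, ⟨hdD, (ha x).trans_lt hd.1, hd.2.trans_le (hb y)⟩, hd⟩
  have : Countable D' := (hDc.mono fun d hd => hd.1).to_subtype
  have : Countable E := hEc.to_subtype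
  have : Nonempty D' := let ⟨d, hd, _⟩ := hDd a b hab; ⟨⟨d, hd⟩⟩
  have : Nonempty E := let ⟨e, he, _⟩ := hEd 0 1 le_rfl one_pos le_rfl; ⟨⟨e, he⟩⟩
  have : DenselyOrdered D' := ⟨fun x y hxy =>
    let ⟨d, hd, h⟩ := hDd x y hxy; ⟨⟨d, hd⟩, h⟩⟩
  have : DenselyOrdered E := ⟨fun x y hxy =>
    let ⟨d, hd, h⟩ := hEd x y (hE x.2).1.le hxy (hE y.2).2.le; ⟨⟨d, hd⟩, h⟩⟩
  have : NoMinOrder D' := ⟨fun x => let ⟨d, hd, h⟩ := hDd a x x.2.2.1; ⟨⟨d, hd⟩, h.2⟩⟩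
  have : NoMaxOrder D' := ⟨fun x => let ⟨d, hd, h⟩ := hDd x b x.2.2.2; ⟨⟨d, hd⟩, h.1⟩⟩
  have : NoMinOrder E := ⟨fun x =>
    let ⟨d, hd, h⟩ := hEd 0 x le_rfl (hE x.2).1 (hE x.2).2.le; ⟨⟨d, hd⟩, h.2⟩⟩
  have : NoMaxOrder E := ⟨fun x =>
    let ⟨d, hd, h⟩ := hEd x 1 (hE x.2).1.le (hE x.2).2 le_rfl; ⟨⟨d, hd⟩, h.1⟩⟩
  obtain ⟨i⟩ := Order.iso_of_countable_dense D' E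
  let S : K → Set ℝ := fun x => insert 0 {e | ∃ d : D', (d : K) ≤ x ∧ (i d : ℝ) = e}
  have hne : ∀ x, (S x).Nonempty := fun x => ⟨0, mem_insert _ _⟩
  have hS1 : ∀ x, ∀ e ∈ S x, e ≤ 1 := by
    rintro x e (rfl | ⟨d, -, rfl⟩)
    · exact zero_le_one
    · exact (hE (i d).2).2.le
  have hbdd : ∀ x, BddAbove (S x) := fun x => ⟨1, hS1 x⟩
  let ψ : K → ℝ := fun x => sSup (S x)
  have h0 : ∀ x, 0 ≤ ψ x := fun x => le_csSup (hbdd x) (mem_insert _ _)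
  have h1 : ∀ x, ψ x ≤ 1 := fun x => csSup_le (hne x) (hS1 x)
  have hlow : ∀ (d : D') x, (d : K) ≤ x → (i d : ℝ) ≤ ψ x := fun d x h =>
    le_csSup (hbdd x) (mem_insert_of_mem _ ⟨d, h, rfl⟩)
  have hupp : ∀ (d : D') x, x ≤ (d : K) → ψ x ≤ (i d : ℝ) := by
    intro d x h
    refine csSup_le (hne x) ?_
    rintro e (rfl | ⟨d', h', rfl⟩)
    · exact (hE (i d).2).1.le
    · exact i.monotone (show d' ≤ d from h'.trans h)
  have hψd : ∀ d : D', ψ d = i d := fun d => le_antisymm (hupp d d le_rfl) (hlow d d le_rfl)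
  have ha0 : ψ a = 0 := by
    refine le_antisymm (csSup_le (hne a) ?_) (h0 a)
    rintro e (rfl | ⟨d', h', rfl⟩)
    · exact le_rfl
    · exact absurd d'.2.2.1 (not_lt.2 h')
  have hb1 : ψ b = 1 := by
    refine le_antisymm (h1 b) (le_of_not_gt fun h => ?_)
    obtain ⟨e, he, h2, -⟩ := hEd _ _ (h0 b) h le_rfl
    have := hlow (i.symm ⟨e, he⟩) b (hb _)
    rw [i.apply_symm_apply] at this
    exact absurd h2 (not_lt.2 this)
  have hcont : Continuous ψ := by
    rw [continuous_iff_lower_upperSemicontinuous, lowerSemicontinuous_iff_isOpen_preimage,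
      upperSemicontinuous_iff_isOpen_preimage]
    constructor
    · refine fun c => isOpen_iff_mem_nhds.2 fun x hx => ?_
      rcases lt_or_ge c 0 with hc | hc
      · exact univ_mem' fun y => hc.trans_le (h0 y)
      obtain ⟨e, (rfl | ⟨d, hdx, rfl⟩), hce⟩ := exists_lt_of_lt_csSup (hne x) hx
      · exact absurd hce (not_lt.2 hc)
      obtain ⟨e, he, hce', hed⟩ := hEd c (i d) hc hce (hE (i d).2).2.le
      have hlt : i.symm ⟨e, he⟩ < d := by rw [i.symm_apply_lt]; exact hed
      filter_upwards [Ioi_mem_nhds (show ((i.symm ⟨e, he⟩ : D') : K) < x from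
        lt_of_lt_of_le hlt hdx)] with y hy
      have := hlow (i.symm ⟨e, he⟩) y (le_of_lt hy)
      rw [i.apply_symm_apply] at this
      exact hce'.trans_le this
    · refine fun c => isOpen_iff_mem_nhds.2 fun x hx => ?_
      rcases lt_or_ge 1 c with hc | hc
      · exact univ_mem' fun y => (h1 y).trans_lt hc
      obtain ⟨e, he, hxe, hec⟩ := hEd (ψ x) c (h0 x) hx hc
      have hlt : x < ((i.symm ⟨e, he⟩ : D') : K) := by
        refine lt_of_not_ge fun h => ?_
        have := hlow _ x h
        rw [i.apply_symm_apply] at this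
        exact absurd hxe (not_lt.2 this)
      filter_upwards [Iio_mem_nhds hlt] with y hy
      have := hupp _ y (le_of_lt hy)
      rw [i.apply_symm_apply] at this
      exact this.trans_lt hec
  refine ⟨ψ, hcont, fun x y hxy => ?_, ha0, hb1, ?_, fun d hd hda hdb => ?_⟩
  · obtain ⟨d, hd, hxd, hdy⟩ := hDd x y hxy
    obtain ⟨d', hd', hdd', hdy'⟩ := hDd d y hdy
    calc ψ x ≤ i ⟨d, hd⟩ := hupp ⟨d, hd⟩ x hxd.le
      _ < i ⟨d', hd'⟩ := i.strictMono (show (⟨d, hd⟩ : D') < ⟨d', hd'⟩ from hdd')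
      _ ≤ ψ y := hlow ⟨d', hd'⟩ y hdy'.le
  · refine Subset.antisymm (range_subset_iff.2 fun x => ⟨h0 x, h1 x⟩) fun r hr => ?_
    rcases hr.2.eq_or_lt with rfl | hr1
    · exact ⟨b, hb1⟩
    rw [← (isCompact_range hcont).isClosed.closure_eq, Metric.mem_closure_iff]
    intro ε hε
    obtain ⟨e, he, hre, her⟩ := hEd r (min (r + ε) 1) hr.1 (lt_min (by linarith) hr1)
      (min_le_right _ _)
    refine ⟨e, ⟨i.symm ⟨e, he⟩, by rw [hψd, i.apply_symm_apply]⟩, ?_⟩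
    rw [dist_comm, Real.dist_eq, abs_of_pos (by linarith)]
    linarith [her.trans_le (min_le_left _ _)]
  · have hd' : d ∈ D' := ⟨hd, lt_of_le_of_ne (ha d) (Ne.symm hda), lt_of_le_of_ne (hb d) hdb⟩
    rw [show ψ d = i ⟨d, hd'⟩ from hψd ⟨d, hd'⟩]
    exact (i _).2

end Parametrization

section PathToArc

variable {X : Type*} [MetricSpace X]

/-- `γ` restricted to `[s, t]` is a nondegenerate arc. -/
structure IsArcOn (γ : ℝ → X) (s t : ℝ) : Prop where
  lt : s < t
  cont : ContinuousOn γ (Icc s t)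
  inj : InjOn γ (Icc s t)

lemma exists_closed_set_gaps_iff {f : ℝ → X} (hf : ContinuousOn f (Icc 0 1)) :
    ∃ C ⊆ Icc (0 : ℝ) 1, IsClosed C ∧ 0 ∈ C ∧ 1 ∈ C ∧
      ∀ s ∈ C, ∀ t ∈ C, s < t → (f s = f t ↔ Disjoint (Ioo s t) C) := by
  let S : Set (Set ℝ) := {C | C ⊆ Icc (0 : ℝ) 1 ∧ IsClosed C ∧ 0 ∈ C ∧ 1 ∈ C ∧
      ∀ s ∈ C, ∀ t ∈ C, s < t → Disjoint (Ioo s t) C → f s = f t}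
  have base : Icc (0 : ℝ) 1 ∈ S := by
    refine ⟨Subset.rfl, isClosed_Icc, by simp, by simp, fun s hs t ht hst hd => ?_⟩
    exact (disjoint_left.1 hd (show (s + t) / 2 ∈ Ioo s t from ⟨by linarith, by linarith⟩)
      ⟨by linarith [hs.1], by linarith [ht.2]⟩).elim
  have chain : ∀ c ⊆ S, IsChain (· ⊆ ·) c → c.Nonempty → ∃ lb ∈ S, ∀ s ∈ c, lb ⊆ s := by
    intro c hcS hc hcne
    refine ⟨⋂₀ c, ⟨?_, isClosed_sInter fun C hC => (hcS hC).2.1, fun C hC => (hcS hC).2.2.1,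
      fun C hC => (hcS hC).2.2.2.1, fun s hs t ht hst hd => ?_⟩, fun C hC => sInter_subset_of_mem hC⟩
    · obtain ⟨C, hC⟩ := hcne
      exact (sInter_subset_of_mem hC).trans (hcS hC).1
    by_contra hne
    obtain ⟨C₀, hC₀⟩ := hcne
    have hsI := (hcS hC₀).1 (hs C₀ hC₀)
    have htI := (hcS hC₀).1 (ht C₀ hC₀)
    obtain ⟨U, V, hU, hV, hsU, htV, hUV⟩ := t2_separation hne
    obtain ⟨ε₁, hε₁, h1⟩ := Metric.mem_nhdsWithin_iff.1 ((hf s hsI).preimage_mem_nhdsWithin (hU.mem_nhds hsU))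
    obtain ⟨ε₂, hε₂, h2⟩ := Metric.mem_nhdsWithin_iff.1 ((hf t htI).preimage_mem_nhdsWithin (hV.mem_nhds htV))
    obtain ⟨ε, hε, hεs⟩ : ∃ ε > 0, ε < ε₁ ∧ ε < ε₂ ∧ s + ε < t - ε := by
      refine ⟨min (min ε₁ ε₂) ((t - s) / 2) / 2, by have : 0 < t - s := sub_pos.2 hst
                                                    positivity, ?_, ?_, ?_⟩
      all_goals
        have : 0 < t - s := sub_pos.2 hst
        have h3 := min_le_left (min ε₁ ε₂) ((t - s) / 2)
        have h4 := min_le_right (min ε₁ ε₂) ((t - s) / 2)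
        have h5 := min_le_left ε₁ ε₂
        have h6 := min_le_right ε₁ ε₂
        linarith
    obtain ⟨hεa, hεb, hεc⟩ := hεs
    have : Nonempty c := ⟨⟨C₀, hC₀⟩⟩
    obtain ⟨⟨C, hC⟩, hCd⟩ := (isCompact_Icc (a := s + ε) (b := t - ε)).elim_directed_family_closed
      (fun C : c => (C : Set ℝ)) (fun C => (hcS C.2).2.1) (by
        refine eq_empty_iff_forall_notMem.2 fun u hu => disjoint_left.1 hd
          (show u ∈ Ioo s t from ⟨by linarith [hu.1.1], by linarith [hu.1.2]⟩) ?_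
        exact fun C hC => mem_iInter.1 hu.2 ⟨C, hC⟩)
      (fun A B => (hc.total A.2 B.2).elim (fun h => ⟨A, Subset.rfl, h⟩) fun h => ⟨B, h, Subset.rfl⟩)
    obtain ⟨-, hCc, -, -, hCg⟩ := hcS hC
    have c1 : IsCompact (C ∩ Icc s (s + ε)) := isCompact_Icc.inter_left hCc
    have c2 : IsCompact (C ∩ Icc (t - ε) t) := isCompact_Icc.inter_left hCc
    obtain ⟨s', hs', hs'max⟩ := c1.exists_isGreatest ⟨s, hs C hC, le_rfl, by linarith⟩
    obtain ⟨t', ht', ht'min⟩ := c2.exists_isLeast ⟨t, ht C hC, by linarith, le_rfl⟩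
    have hst' : s' < t' := by linarith [hs'.2.2, ht'.2.1]
    have heq := hCg s' hs'.1 t' ht'.1 hst' (disjoint_left.2 fun u hu huC => by
      rcases le_or_gt u (s + ε) with h3 | h3
      · linarith [hs'max ⟨huC, hs'.2.1.trans hu.1.le, h3⟩, hu.1]
      rcases le_or_gt (t - ε) u with h4 | h4
      · linarith [ht'min ⟨huC, h4, hu.2.le.trans ht'.2.2⟩, hu.2]
      exact (hCd ▸ (⟨⟨h3.le, h4.le⟩, huC⟩ : u ∈ Icc (s + ε) (t - ε) ∩ C) : u ∈ (∅ : Set ℝ)))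
    have hsU' : f s' ∈ U := h1 ⟨?_, (hcS hC).1 hs'.1⟩
    · have htV' : f t' ∈ V := h2 ⟨?_, (hcS hC).1 ht'.1⟩
      · exact disjoint_left.1 hUV hsU' (heq ▸ htV')
      · rw [Metric.mem_ball', Real.dist_eq, abs_of_nonneg (by linarith [ht'.2.2])]
        linarith [ht'.2.1]
    · rw [Metric.mem_ball, Real.dist_eq, abs_of_nonneg (by linarith [hs'.2.1])]
      linarith [hs'.2.2]
  obtain ⟨C, -, hC⟩ := zorn_superset_nonempty S chain _ base
  obtain ⟨hCI, hCc, hC0, hC1, hCg⟩ := hC.prop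
  refine ⟨C, hCI, hCc, hC0, hC1, fun s hs t ht hst => ⟨fun h => ?_, hCg s hs t ht hst⟩⟩
  have hmem : C \ Ioo s t ∈ S := by
    refine ⟨sdiff_subset.trans hCI, hCc.sdiff isOpen_Ioo,
      ⟨hC0, fun h => absurd h.1 (not_lt.2 (hCI hs).1)⟩,
      ⟨hC1, fun h => absurd h.2 (not_lt.2 (hCI ht).2)⟩, fun s' hs' t' ht' hst' hd => ?_⟩
    have e1 : s ∉ Ioo s' t' := fun h1 =>
      disjoint_left.1 hd h1 ⟨hs, fun h2 => lt_irrefl _ h2.1⟩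
    have e2 : t ∉ Ioo s' t' := fun h1 =>
      disjoint_left.1 hd h1 ⟨ht, fun h2 => lt_irrefl _ h2.2⟩
    have e3 := hs'.2
    have e4 := ht'.2
    simp only [mem_Ioo, not_and, not_lt] at e1 e2 e3 e4
    by_cases h1 : t' ≤ s
    · refine hCg s' hs'.1 t' ht'.1 hst' (disjoint_left.2 fun u hu huC =>
        disjoint_left.1 hd hu ⟨huC, fun h2 => ?_⟩)
      linarith [h2.1, hu.2]
    by_cases h2 : t ≤ s'
    · refine hCg s' hs'.1 t' ht'.1 hst' (disjoint_left.2 fun u hu huC =>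
        disjoint_left.1 hd hu ⟨huC, fun h2 => ?_⟩)
      linarith [h2.2, hu.1]
    push Not at h1 h2
    have e5 : s' = s := by
      refine le_antisymm (not_lt.1 fun h3 => ?_) (not_lt.1 fun h3 => ?_)
      · linarith [e3 h3]
      · linarith [e1 h3]
    have e6 : t = t' := by
      refine le_antisymm (not_lt.1 fun h3 => ?_) (not_lt.1 fun h3 => ?_)
      · linarith [e4 h1]
      · linarith [e2 h2]
    rw [e5, h, e6]
  have := hC.le_of_le hmem sdiff_subset
  exact disjoint_left.2 fun u hu huC => (this huC).2 hu

lemma exists_arc_of_continuousOn {f : ℝ → X} (hf : ContinuousOn f (Icc 0 1)) (hne : f 0 ≠ f 1) :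
    ∃ γ : ℝ → X, IsArcOn γ 0 1 ∧ γ 0 = f 0 ∧ γ 1 = f 1 ∧ γ '' Icc 0 1 ⊆ f '' Icc 0 1 := by
  obtain ⟨C, hCI, hCc, hC0, hC1, hC⟩ := exists_closed_set_gaps_iff hf
  have hCk : IsCompact C := isCompact_Icc.of_isClosed_subset hCc hCI
  have hfC : ContinuousOn f C := hf.mono hCI
  -- two points of `C` with the same image have no point of `C` in between
  have gap : ∀ s ∈ C, ∀ t ∈ C, ∀ u ∈ C, s < u → u < t → f s ≠ f t := fun s hs t ht u hu h1 h2 h =>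
    disjoint_left.1 ((hC s hs t ht (h1.trans h2)).1 h) ⟨h1, h2⟩ hu
  have btw : ∀ s ∈ C, ∀ t ∈ C, s < t → f s ≠ f t → ∃ u ∈ C, s < u ∧ u < t := by
    intro s hs t ht hst h
    rw [Ne, hC s hs t ht hst, not_disjoint_iff] at h
    obtain ⟨u, hu, huC⟩ := h
    exact ⟨u, huC, hu⟩
  have hmin : ∀ p : f '' C, ∃ s ∈ C, f s = p ∧ ∀ t ∈ C, f t = p → s ≤ t := by
    intro p
    have hk : IsCompact (C ∩ f ⁻¹' {(p : X)}) :=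
      hCk.of_isClosed_subset (hfC.preimage_isClosed_of_isClosed hCc isClosed_singleton)
        inter_subset_left
    obtain ⟨s, hs, hsm⟩ := hk.exists_isLeast (let ⟨t, ht, h⟩ := p.2; ⟨t, ht, h⟩)
    exact ⟨s, hs.1, hs.2, fun t ht h => hsm ⟨ht, h⟩⟩
  choose m hmC hmf hmle using hmin
  have hminj : Function.Injective m := fun p q h => Subtype.ext (by rw [← hmf, ← hmf, h])
  let _ : LinearOrder (f '' C) := LinearOrder.lift' m hminj
  have le_iff : ∀ p q : f '' C, p ≤ q ↔ m p ≤ m q := fun _ _ => Iff.rfl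
  have lt_iff : ∀ p q : f '' C, p < q ↔ m p < m q := fun _ _ => Iff.rfl
  let F : C → f '' C := fun s => ⟨f s, mem_image_of_mem f s.2⟩
  have hmF : ∀ s : C, m (F s) ≤ s := fun s => hmle (F s) s s.2 rfl
  have Fm : ∀ p, F ⟨m p, hmC p⟩ = p := fun p => Subtype.ext (hmf p)
  have Fmono : Monotone F := by
    intro s t hst
    rw [le_iff]
    by_contra h
    rw [not_le] at h
    have h1 : (t : ℝ) = m (F s) := by
      refine le_antisymm (not_lt.1 fun h2 => ?_) ((hmF s).trans hst)
      exact gap _ (hmC (F t)) t t.2 _ (hmC (F s)) h h2 (hmf (F t))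
    have h2 : s = t := le_antisymm hst (h1.le.trans (hmF s))
    rw [h2] at h
    exact lt_irrefl _ h
  have Fc : Continuous F := (continuousOn_iff_continuous_domRestrict.1 hfC).subtype_mk _
  have : CompactSpace C := isCompact_iff_compactSpace.1 hCk
  have Fsurj : Function.Surjective F := fun p => ⟨_, Fm p⟩
  have : CompactSpace (f '' C) := isCompact_iff_compactSpace.1 (hCk.image_of_continuousOn hfC)
  have : ClosedIciTopology (f '' C) := ⟨fun p => by
    have : Ici p = F '' Ici ⟨m p, hmC p⟩ := by
      ext q
      constructor
      · exact fun h => ⟨⟨m q, hmC q⟩, h, Fm q⟩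
      · rintro ⟨s, hs, rfl⟩
        exact (Fm p).symm.le.trans (Fmono hs)
    rw [this]
    exact (isClosed_Ici.isCompact.image Fc).isClosed⟩
  have : ClosedIicTopology (f '' C) := ⟨fun p => by
    have : Iic p = F '' Iic ⟨m p, hmC p⟩ := by
      ext q
      constructor
      · exact fun h => ⟨⟨m q, hmC q⟩, h, Fm q⟩
      · rintro ⟨s, hs, rfl⟩
        exact (Fmono hs).trans (Fm p).le
    rw [this]
    exact (isClosed_Iic.isCompact.image Fc).isClosed⟩
  have between : ∀ p q : f '' C, ∀ u : C, p ≤ q → m p < u → u < m q → f u ≠ p → p < F u ∧ F u < q := by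
    intro p q u _ h1 h2 h3
    constructor
    · refine lt_of_le_of_ne ((Fm p).symm.le.trans (Fmono (show (⟨m p, hmC p⟩ : C) ≤ u from h1.le)))
        fun h => h3 (by rw [h])
    · exact (lt_iff _ _).2 ((hmF u).trans_lt h2)
  have : DenselyOrdered (f '' C) := ⟨fun p q hpq => by
    have hne' : f (m p) ≠ f (m q) := by
      rw [hmf, hmf]; exact fun h => hpq.ne (Subtype.ext h)
    obtain ⟨u, hu, h1, h2⟩ := btw _ (hmC p) _ (hmC q) hpq hne'
    by_cases h3 : f u = p
    · obtain ⟨v, hv, h4, h5⟩ := btw u hu _ (hmC q) h2 (by rwa [h3, ← hmf p])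
      refine ⟨F ⟨v, hv⟩, between p q ⟨v, hv⟩ hpq.le (h1.trans h4) h5 fun h6 => ?_⟩
      exact gap _ (hmC p) v hv u hu h1 h4 ((hmf p).trans h6.symm)
    · exact ⟨F ⟨u, hu⟩, between p q ⟨u, hu⟩ hpq.le h1 h2 h3⟩⟩
  obtain ⟨D, hDc, hD⟩ := TopologicalSpace.exists_countable_dense (f '' C)
  obtain ⟨ψ, ψc, ψm, ψ0, ψ1, ψr, -⟩ := exists_continuous_strictMono_onto_Icc
    (a := F ⟨0, hC0⟩) (b := F ⟨1, hC1⟩)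
    (fun p => (Fmono (show (⟨0, hC0⟩ : C) ≤ ⟨m p, hmC p⟩ from (hCI (hmC p)).1)).trans (Fm p).le)
    (fun p => (Fm p).symm.le.trans (Fmono (show ⟨m p, hmC p⟩ ≤ (⟨1, hC1⟩ : C) from (hCI (hmC p)).2)))
    (lt_of_le_of_ne (Fmono (show (⟨0, hC0⟩ : C) ≤ ⟨1, hC1⟩ from zero_le_one (α := ℝ)))
      fun h => hne (congrArg Subtype.val h)) hDc hD
    (E := Ioo 0 1 ∩ range ((↑) : ℚ → ℝ)) inter_subset_left
    ((countable_range _).mono inter_subset_right) (fun s t h0 hst h1 => by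
      obtain ⟨q, hq1, hq2⟩ := exists_rat_btwn hst
      exact ⟨q, ⟨⟨h0.trans_lt hq1, hq2.trans_le h1⟩, q, rfl⟩, hq1, hq2⟩)
  have ψe : IsClosedEmbedding ψ := ψc.isClosedEmbedding ψm.injective
  have hinv : ∀ t : ℝ, ∃ p, t ∈ Icc (0 : ℝ) 1 → ψ p = t := by
    intro t
    by_cases ht : t ∈ Icc (0 : ℝ) 1
    · obtain ⟨p, hp⟩ := ψr.symm ▸ ht
      exact ⟨p, fun _ => hp⟩
    · exact ⟨F ⟨0, hC0⟩, fun h => absurd h ht⟩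
  choose κ hκ using hinv
  have i0 : (0 : ℝ) ∈ Icc (0 : ℝ) 1 := by simp
  have i1 : (1 : ℝ) ∈ Icc (0 : ℝ) 1 := by simp
  refine ⟨fun t => κ t, ⟨one_pos, ?_, ?_⟩, ?_, ?_, ?_⟩
  · refine continuous_subtype_val.comp_continuousOn ?_
    rw [ψe.isInducing.continuousOn_iff]
    exact continuousOn_id.congr hκ
  · intro s hs t ht h
    rw [← hκ s hs, ← hκ t ht, Subtype.ext h]
  · have : κ 0 = F ⟨0, hC0⟩ := ψm.injective ((hκ 0 i0).trans ψ0.symm)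
    show (κ 0 : X) = f 0
    rw [this]
  · have : κ 1 = F ⟨1, hC1⟩ := ψm.injective ((hκ 1 i1).trans ψ1.symm)
    show (κ 1 : X) = f 1
    rw [this]
  · rintro _ ⟨t, -, rfl⟩
    exact image_mono hCI (κ t).2

end PathToArc

section Circles

variable {X : Type*} [MetricSpace X]

lemma isSimpleClosedCurve_image_of_injOn {γ : ℝ → X} (hγ : ContinuousOn γ (Icc 0 1))
    (h01 : γ 0 = γ 1) (hinj : InjOn γ (Ico 0 1)) :
    ∃ S : Set X, IsSimpleClosedCurve S := by
  have : Fact ((0 : ℝ) < 1) := ⟨one_pos⟩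
  have hc := AddCircle.liftIco_zero_continuous h01 hγ
  have hi : Function.Injective (AddCircle.liftIco 1 0 γ) := by
    intro p q hpq
    obtain ⟨s, rfl⟩ := (AddCircle.equivIco (1 : ℝ) 0).symm.surjective p
    obtain ⟨t, rfl⟩ := (AddCircle.equivIco (1 : ℝ) 0).symm.surjective q
    change AddCircle.liftIco 1 0 γ ((s : ℝ) : AddCircle (1 : ℝ)) =
      AddCircle.liftIco 1 0 γ ((t : ℝ) : AddCircle (1 : ℝ)) at hpq
    rw [AddCircle.liftIco_coe_apply s.2, AddCircle.liftIco_coe_apply t.2] at hpq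
    rw [Subtype.ext (hinj (by simpa using s.2) (by simpa using t.2) hpq)]
  exact ⟨_, ⟨(hc.isClosedEmbedding hi).isEmbedding.toHomeomorph.symm⟩⟩

lemma IsArcOn.exists_isSimpleClosedCurve {α β : ℝ → X} {a b c d : ℝ} (hα : IsArcOn α a b)
    (hβ : IsArcOn β c d) (hac : α a = β c) (hbd : α b = β d)
    (hdisj : ∀ s ∈ Ioo a b, ∀ u ∈ Icc c d, α s ≠ β u) : ∃ S : Set X, IsSimpleClosedCurve S := by
  have hab := hα.lt
  have hcd := hβ.lt
  let p : ℝ → ℝ := fun t => a + 2 * t * (b - a)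
  let q : ℝ → ℝ := fun t => d - (2 * t - 1) * (d - c)
  have pm : ∀ t ∈ Icc (0 : ℝ) (1 / 2), p t ∈ Icc a b := fun t ht =>
    ⟨by have := ht.1; simp only [p]; nlinarith, by have := ht.2; simp only [p]; nlinarith⟩
  have qm : ∀ t ∈ Icc (1 / 2 : ℝ) 1, q t ∈ Icc c d := fun t ht =>
    ⟨by have := ht.2; simp only [q]; nlinarith, by have := ht.1; simp only [q]; nlinarith⟩
  have qm' : ∀ t ∈ Ioo (1 / 2 : ℝ) 1, q t ∈ Ioo c d := fun t ht =>
    ⟨by have := ht.2; simp only [q]; nlinarith, by have := ht.1; simp only [q]; nlinarith⟩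
  have pinj : Function.Injective p := fun s t h => by
    have : s * (b - a) = t * (b - a) := by simp only [p] at h; linarith
    exact mul_right_cancel₀ (by linarith) this
  have qinj : Function.Injective q := fun s t h => by
    have : s * (d - c) = t * (d - c) := by simp only [q] at h; linarith
    exact mul_right_cancel₀ (by linarith) this
  have pc : Continuous p := by fun_prop
  have qc : Continuous q := by fun_prop
  let ρ : ℝ → X := fun t => if t ≤ 1 / 2 then α (p t) else β (q t)
  have h1 : EqOn ρ (α ∘ p) (Icc 0 (1 / 2)) := fun t ht => if_pos ht.2
  have h2 : EqOn ρ (β ∘ q) (Icc (1 / 2) 1) := fun t ht => by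
    rcases eq_or_lt_of_le ht.1 with h | h
    · have e1 : p (1 / 2) = b := by simp only [p]; ring
      have e2 : q (1 / 2) = d := by simp only [q]; ring
      rw [← h]
      simp only [ρ, le_refl, if_true, Function.comp_apply]
      rw [e1, e2, hbd]
    · exact if_neg (not_le.2 h)
  have cross : ∀ s ∈ Icc (0 : ℝ) (1 / 2), ∀ t ∈ Ioo (1 / 2 : ℝ) 1, α (p s) ≠ β (q t) := by
    intro s hs t ht h
    have hq := qm' t ht
    have hp := pm s hs
    rcases eq_or_lt_of_le hp.1 with h3 | h3
    · rw [← h3, hac] at h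
      exact hq.1.ne (hβ.inj (left_mem_Icc.2 hcd.le) (Ioo_subset_Icc_self hq) h)
    rcases eq_or_lt_of_le hp.2 with h4 | h4
    · rw [h4, hbd] at h
      exact hq.2.ne' (hβ.inj (right_mem_Icc.2 hcd.le) (Ioo_subset_Icc_self hq) h)
    exact hdisj _ ⟨h3, h4⟩ _ (Ioo_subset_Icc_self hq) h
  refine isSimpleClosedCurve_image_of_injOn (γ := ρ) ?_ ?_ ?_
  · rw [← Icc_union_Icc_eq_Icc (b := (1 / 2 : ℝ)) (by norm_num) (by norm_num)]
    exact ((hα.cont.comp pc.continuousOn pm).congr h1).union_of_isClosed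
      ((hβ.cont.comp qc.continuousOn qm).congr h2) isClosed_Icc isClosed_Icc
  · rw [h1 ⟨le_rfl, by norm_num⟩, h2 ⟨by norm_num, le_rfl⟩]
    have e1 : p 0 = a := by simp only [p]; ring
    have e2 : q 1 = c := by simp only [q]; ring
    rw [Function.comp_apply, Function.comp_apply, e1, e2, hac]
  · intro s hs t ht h
    rcases le_or_gt s (1 / 2) with h3 | h3 <;> rcases le_or_gt t (1 / 2) with h4 | h4
    · rw [h1 ⟨hs.1, h3⟩, h1 ⟨ht.1, h4⟩] at h
      exact pinj (hα.inj (pm s ⟨hs.1, h3⟩) (pm t ⟨ht.1, h4⟩) h)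
    · rw [h1 ⟨hs.1, h3⟩, h2 ⟨h4.le, ht.2.le⟩] at h
      exact (cross s ⟨hs.1, h3⟩ t ⟨h4, ht.2⟩ h).elim
    · rw [h1 ⟨ht.1, h4⟩, h2 ⟨h3.le, hs.2.le⟩] at h
      exact (cross t ⟨ht.1, h4⟩ s ⟨h3, hs.2⟩ h.symm).elim
    · rw [h2 ⟨h3.le, hs.2.le⟩, h2 ⟨h4.le, ht.2.le⟩] at h
      exact qinj (hβ.inj (qm s ⟨h3.le, hs.2.le⟩) (qm t ⟨h4.le, ht.2.le⟩) h)

lemma IsArcOn.mono {γ : ℝ → X} {a b c d : ℝ} (h : IsArcOn γ a b) (hac : a ≤ c) (hcd : c < d)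
    (hdb : d ≤ b) : IsArcOn γ c d :=
  ⟨hcd, h.cont.mono (Icc_subset_Icc hac hdb), h.inj.mono (Icc_subset_Icc hac hdb)⟩

lemma IsArcOn.neg {γ : ℝ → X} {a b : ℝ} (h : IsArcOn γ a b) :
    IsArcOn (fun t => γ (-t)) (-b) (-a) := by
  have hm : MapsTo (fun t : ℝ => -t) (Icc (-b) (-a)) (Icc a b) := fun t ht =>
    ⟨by linarith [ht.2], by linarith [ht.1]⟩
  exact ⟨neg_lt_neg h.lt, h.cont.comp continuous_neg.continuousOn hm,
    h.inj.comp neg_injective.injOn hm⟩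

end Circles

/-- A space without simple closed curves. -/
class AcyclicSpace (X : Type*) [TopologicalSpace X] : Prop where
  not_isSimpleClosedCurve : ∀ S : Set X, ¬ IsSimpleClosedCurve S

section Arcs

lemma exists_continuousOn_of_isCompletelyMetrizable {Z : Type*} [TopologicalSpace Z]
    [TopologicalSpace.IsCompletelyMetrizableSpace Z] [LocallyConnectedSpace Z]
    [PreconnectedSpace Z] (x y : Z) :
    ∃ f : ℝ → Z, ContinuousOn f (Icc 0 1) ∧ f 0 = x ∧ f 1 = y := by
  let _ : MetricSpace Z := TopologicalSpace.completelyMetrizableMetric Z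
  have : CompleteSpace Z := TopologicalSpace.complete_completelyMetrizableMetric Z
  exact exists_continuousOn_joining x y

variable {X : Type*} [MetricSpace X] [CompactSpace X] [LocallyConnectedSpace X]

lemma exists_arc_of_isOpen_isPreconnected {U : Set X} (hU : IsOpen U) (hUc : IsPreconnected U)
    {x y : X} (hx : x ∈ U) (hy : y ∈ U) (hxy : x ≠ y) :
    ∃ γ : ℝ → X, IsArcOn γ 0 1 ∧ γ 0 = x ∧ γ 1 = y ∧ γ '' Icc 0 1 ⊆ U := by
  have : PolishSpace U := hU.polishSpace
  have : LocallyConnectedSpace U := hU.locallyConnectedSpace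
  have : PreconnectedSpace U := isPreconnected_iff_preconnectedSpace.1 hUc
  obtain ⟨f, hf, f0, f1⟩ := exists_continuousOn_of_isCompletelyMetrizable (⟨x, hx⟩ : U) ⟨y, hy⟩
  obtain ⟨γ, hγ, h0, h1, hi⟩ := exists_arc_of_continuousOn (f := fun t => (f t : X))
    (continuous_subtype_val.comp_continuousOn hf) (by simp only [f0, f1]; exact hxy)
  refine ⟨γ, hγ, by rw [h0, f0], by rw [h1, f1], hi.trans ?_⟩
  rintro _ ⟨t, -, rfl⟩
  exact (f t).2

lemma exists_arc [ConnectedSpace X] {x y : X} (hxy : x ≠ y) : ∃ γ : ℝ → X, IsArcOn γ 0 1 ∧ γ 0 = x ∧ γ 1 = y := by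
  obtain ⟨γ, h, h0, h1, -⟩ :=
    exists_arc_of_isOpen_isPreconnected isOpen_univ isPreconnected_univ (mem_univ x) (mem_univ y) hxy
  exact ⟨γ, h, h0, h1⟩

lemma IsArcOn.mem_of_isPreconnected [AcyclicSpace X] {γ : ℝ → X} {a b : ℝ} (hγ : IsArcOn γ a b)
    {T : Set X} (hT : IsPreconnected T) (ha : γ a ∈ T) (hb : γ b ∈ T) {t : ℝ} (ht : t ∈ Icc a b) :
    γ t ∈ T := by
  by_contra hz
  have hab := hγ.lt
  have hTU : T ⊆ connectedComponentIn {γ t}ᶜ (γ a) :=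
    hT.subset_connectedComponentIn ha fun u hu h => hz (h ▸ hu)
  obtain ⟨η, hη, η0, η1, hηU⟩ := exists_arc_of_isOpen_isPreconnected
    isOpen_compl_singleton.connectedComponentIn isPreconnected_connectedComponentIn
    (hTU ha) (hTU hb) (fun h => hab.ne (hγ.inj (left_mem_Icc.2 hab.le) (right_mem_Icc.2 hab.le) h))
  have htη : γ t ∉ η '' Icc 0 1 := fun h => connectedComponentIn_subset _ _ (hηU h) rfl
  have hk : IsClosed (η '' Icc 0 1) := (isCompact_Icc.image_of_continuousOn hη.cont).isClosed
  have e0 : γ a ∈ η '' Icc 0 1 := ⟨0, by simp, η0⟩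
  have e1 : γ b ∈ η '' Icc 0 1 := ⟨1, by simp, η1⟩
  have hat : Icc a t ⊆ Icc a b := Icc_subset_Icc le_rfl ht.2
  have htb : Icc t b ⊆ Icc a b := Icc_subset_Icc ht.1 le_rfl
  have k1 : IsCompact (Icc a t ∩ γ ⁻¹' (η '' Icc 0 1)) := isCompact_Icc.of_isClosed_subset
    ((hγ.cont.mono hat).preimage_isClosed_of_isClosed isClosed_Icc hk) inter_subset_left
  have k2 : IsCompact (Icc t b ∩ γ ⁻¹' (η '' Icc 0 1)) := isCompact_Icc.of_isClosed_subset
    ((hγ.cont.mono htb).preimage_isClosed_of_isClosed isClosed_Icc hk) inter_subset_left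
  obtain ⟨c, ⟨hc, p, hp, hpc⟩, hcm⟩ := k1.exists_isGreatest ⟨a, ⟨le_rfl, ht.1⟩, e0⟩
  obtain ⟨d, ⟨hd, q, hq, hqd⟩, hdm⟩ := k2.exists_isLeast ⟨b, ⟨ht.2, le_rfl⟩, e1⟩
  have hct : c < t := lt_of_le_of_ne hc.2 fun h => htη (h ▸ ⟨p, hp, hpc⟩)
  have htd : t < d := lt_of_le_of_ne hd.1 fun h => htη (h ▸ ⟨q, hq, hqd⟩)
  have hcd := hγ.mono hc.1 (hct.trans htd) hd.2
  have key : ∀ s ∈ Ioo c d, ∀ u ∈ Icc (0 : ℝ) 1, γ s ≠ η u := by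
    intro s hs u hu h
    rcases le_or_gt s t with h1 | h1
    · exact hs.1.not_ge (hcm ⟨⟨hc.1.trans hs.1.le, h1⟩, u, hu, h.symm⟩)
    · exact hs.2.not_ge (hdm ⟨⟨h1.le, hs.2.le.trans hd.2⟩, u, hu, h.symm⟩)
  have hpq : p ≠ q := by
    rintro rfl
    exact hcd.lt.ne (hγ.inj (hat hc) (htb hd) (hpc.symm.trans hqd))
  obtain ⟨S, hS⟩ : ∃ S : Set X, IsSimpleClosedCurve S := by
    rcases lt_or_gt_of_ne hpq with h | h
    · exact hcd.exists_isSimpleClosedCurve (hη.mono hp.1 h hq.2) hpc.symm hqd.symm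
        fun s hs u hu => key s hs u ⟨hp.1.trans hu.1, hu.2.trans hq.2⟩
    · exact hcd.exists_isSimpleClosedCurve (hη.mono hq.1 h hp.2).neg (by simp [hpc])
        (by simp [hqd]) fun s hs u hu =>
          key s hs _ ⟨by linarith [hq.1, hu.2], by linarith [hp.2, hu.1]⟩
  exact AcyclicSpace.not_isSimpleClosedCurve S hS

end Arcs

section Segments

/-- The points lying in every connected set containing `x` and `y`. -/
def seg {X : Type*} [TopologicalSpace X] (x y : X) : Set X :=
  {z | ∀ T : Set X, IsPreconnected T → x ∈ T → y ∈ T → z ∈ T}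

variable {X : Type*} [MetricSpace X]

lemma seg_subset {x y : X} {T : Set X} (hT : IsPreconnected T) (hx : x ∈ T) (hy : y ∈ T) :
    seg x y ⊆ T := fun _ hz => hz T hT hx hy

lemma left_mem_seg (x y : X) : x ∈ seg x y := fun _ _ h _ => h

lemma right_mem_seg (x y : X) : y ∈ seg x y := fun _ _ _ h => h

lemma seg_comm (x y : X) : seg x y = seg y x := by
  ext z
  exact ⟨fun h T hT hx hy => h T hT hy hx, fun h T hT hx hy => h T hT hy hx⟩

lemma seg_self (x : X) : seg x x = {x} :=
  (seg_subset isPreconnected_singleton rfl rfl).antisymm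
    (singleton_subset_iff.2 (left_mem_seg x x))

variable [CompactSpace X] [LocallyConnectedSpace X] [AcyclicSpace X]

lemma IsArcOn.image_eq_seg {γ : ℝ → X} {a b : ℝ} (hγ : IsArcOn γ a b) :
    γ '' Icc a b = seg (γ a) (γ b) := by
  refine Subset.antisymm ?_ (seg_subset (isPreconnected_Icc.image _ hγ.cont)
    (mem_image_of_mem _ (left_mem_Icc.2 hγ.lt.le)) (mem_image_of_mem _ (right_mem_Icc.2 hγ.lt.le)))
  rintro _ ⟨t, ht, rfl⟩ T hT ha hb
  exact hγ.mem_of_isPreconnected hT ha hb ht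

variable [ConnectedSpace X]

lemma isClosed_seg (x y : X) : IsClosed (seg x y) := by
  by_cases hxy : x = y
  · rw [hxy, seg_self]
    exact isClosed_singleton
  · obtain ⟨γ, h, rfl, rfl⟩ := exists_arc hxy
    rw [← h.image_eq_seg]
    exact (isCompact_Icc.image_of_continuousOn h.cont).isClosed

lemma isPreconnected_seg (x y : X) : IsPreconnected (seg x y) := by
  by_cases hxy : x = y
  · rw [hxy, seg_self]
    exact isPreconnected_singleton
  · obtain ⟨γ, h, rfl, rfl⟩ := exists_arc hxy
    rw [← h.image_eq_seg]
    exact isPreconnected_Icc.image _ h.cont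

lemma seg_subset_seg_right {x y z : X} (hz : z ∈ seg x y) : seg z y ⊆ seg x y :=
  seg_subset (isPreconnected_seg x y) hz (right_mem_seg x y)

lemma seg_subset_union (x y z : X) : seg x z ⊆ seg x y ∪ seg y z :=
  seg_subset ((isPreconnected_seg x y).union y (right_mem_seg x y) (left_mem_seg y z)
    (isPreconnected_seg y z)) (Or.inl (left_mem_seg x y)) (Or.inr (right_mem_seg y z))

/-- Two points each separating the other one from `u` coincide. -/
lemma eq_of_mem_seg_of_mem_seg {u p q : X} (hp : p ∈ seg u q) (hq : q ∈ seg u p) : p = q := by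
  by_cases huq : u = q
  · rw [huq, seg_self] at hp
    exact hp
  obtain ⟨γ, h, rfl, rfl⟩ := exists_arc huq
  rw [← h.image_eq_seg] at hp
  obtain ⟨t, ht, rfl⟩ := hp
  by_contra hne
  have h0 : 0 < t := lt_of_le_of_ne ht.1 fun h0 => by
    rw [← h0, seg_self] at hq
    exact huq hq.symm
  rw [← (h.mono le_rfl h0 ht.2).image_eq_seg] at hq
  obtain ⟨s, hs, hst⟩ := hq
  have := h.inj ⟨hs.1, hs.2.trans ht.2⟩ (right_mem_Icc.2 zero_le_one) hst
  exact hne (by rw [le_antisymm ht.2 (this ▸ hs.2)])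

lemma seg_inter_seg {x y z : X} (hz : z ∈ seg x y) : seg x z ∩ seg z y = {z} := by
  refine Subset.antisymm ?_ (singleton_subset_iff.2 ⟨right_mem_seg x z, left_mem_seg z y⟩)
  rintro u ⟨h1, h2⟩
  refine eq_of_mem_seg_of_mem_seg (u := x) h1 ?_
  rcases seg_subset_union x u y hz with h | h
  · exact h
  · rw [seg_comm] at h h2
    rw [eq_of_mem_seg_of_mem_seg h h2]
    exact right_mem_seg x u

lemma notMem_seg_iff {x y b : X} (hb : b ≠ x) :
    b ∉ seg x y ↔ y ∈ connectedComponentIn {b}ᶜ x := by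
  constructor
  · intro h
    exact (isPreconnected_seg x y).subset_connectedComponentIn (left_mem_seg x y)
      (fun z hz (hzb : z = b) => h (hzb ▸ hz)) (right_mem_seg x y)
  · intro h hmem
    exact connectedComponentIn_subset _ _ (hmem _ isPreconnected_connectedComponentIn
      (mem_connectedComponentIn hb.symm) h) rfl

lemma isClosed_setOf_mem_seg (p q : X) : IsClosed {u | p ∈ seg u q} := by
  by_cases hpq : p = q
  · rw [hpq]
    convert isClosed_univ
    exact eq_univ_of_forall fun u => right_mem_seg u q
  · have : {u | p ∈ seg u q} = (connectedComponentIn {p}ᶜ q)ᶜ := by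
      ext u
      rw [mem_compl_iff, ← notMem_seg_iff hpq, not_not, seg_comm]
      rfl
    rw [this, isClosed_compl_iff]
    exact isOpen_compl_singleton.connectedComponentIn

end Segments

section Gates

variable {X : Type*} [MetricSpace X]

/-- Nonempty closed connected subsets. -/
structure IsSubcontinuum (Y : Set X) : Prop where
  isClosed : IsClosed Y
  isPreconnected : IsPreconnected Y
  nonempty : Y.Nonempty

/-- The point of `Y` through which every connected set joining `x` to `Y` passes. -/
noncomputable def gate (Y : Set X) (x : X) : X :=
  @Classical.epsilon X ⟨x⟩ fun r => r ∈ Y ∧ ∀ y ∈ Y, r ∈ seg x y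

variable [CompactSpace X] [LocallyConnectedSpace X] [AcyclicSpace X] [ConnectedSpace X]

lemma IsSubcontinuum.seg (x y : X) : IsSubcontinuum (seg x y) :=
  ⟨isClosed_seg x y, isPreconnected_seg x y, x, left_mem_seg x y⟩

lemma IsSubcontinuum.exists_gate {Y : Set X} (hY : IsSubcontinuum Y) (x : X) :
    ∃ r ∈ Y, ∀ y ∈ Y, r ∈ _root_.seg x y := by
  by_cases hx : x ∈ Y
  · exact ⟨x, hx, fun y _ => left_mem_seg x y⟩
  obtain ⟨y₀, hy₀⟩ := hY.nonempty
  obtain ⟨γ, h, rfl, rfl⟩ := exists_arc (fun h : x = y₀ => hx (h ▸ hy₀))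
  have k : IsCompact (Icc 0 1 ∩ γ ⁻¹' Y) := isCompact_Icc.of_isClosed_subset
    (h.cont.preimage_isClosed_of_isClosed isClosed_Icc hY.isClosed) inter_subset_left
  obtain ⟨t, ⟨ht, htY⟩, htm⟩ := k.exists_isLeast ⟨1, by simp, hy₀⟩
  have h0 : 0 < t := lt_of_le_of_ne ht.1 fun h0 => hx (h0 ▸ htY)
  refine ⟨γ t, htY, fun y hy => ?_⟩
  have h1 : MapsTo γ (Ico 0 t) (_root_.seg (γ 0) y) := by
    intro s hs
    have hs' : γ s ∈ _root_.seg (γ 0) (γ t) := by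
      rw [← (h.mono le_rfl h0 ht.2).image_eq_seg]
      exact mem_image_of_mem _ (Ico_subset_Icc_self hs)
    refine (seg_subset_union _ y _ hs').resolve_right fun h2 => ?_
    exact hs.2.not_ge (htm ⟨⟨hs.1, hs.2.le.trans ht.2⟩, seg_subset hY.isPreconnected hy htY h2⟩)
  have h2 : t ∈ closure (Ico 0 t) := by
    rw [closure_Ico h0.ne]
    exact right_mem_Icc.2 h0.le
  have h3 : ContinuousWithinAt γ (Ico 0 t) t :=
    (h.cont t ht).mono (Ico_subset_Icc_self.trans (Icc_subset_Icc le_rfl ht.2))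
  exact (isClosed_seg (γ 0) y).closure_subset (h3.mem_closure h2 h1)

lemma IsSubcontinuum.gate_mem {Y : Set X} (hY : IsSubcontinuum Y) (x : X) : gate Y x ∈ Y :=
  (Classical.epsilon_spec (hY.exists_gate x)).1

lemma IsSubcontinuum.gate_mem_seg {Y : Set X} (hY : IsSubcontinuum Y) (x : X) {y : X}
    (hy : y ∈ Y) : gate Y x ∈ _root_.seg x y :=
  (Classical.epsilon_spec (hY.exists_gate x)).2 y hy

lemma IsSubcontinuum.eq_gate {Y : Set X} (hY : IsSubcontinuum Y) {x r : X} (hr : r ∈ Y)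
    (h : ∀ y ∈ Y, r ∈ _root_.seg x y) : r = gate Y x :=
  eq_of_mem_seg_of_mem_seg (h _ (hY.gate_mem x)) (hY.gate_mem_seg x hr)

lemma IsSubcontinuum.gate_eq_self {Y : Set X} (hY : IsSubcontinuum Y) {x : X} (hx : x ∈ Y) :
    gate Y x = x :=
  (hY.eq_gate hx fun y _ => left_mem_seg x y).symm

lemma IsSubcontinuum.continuous_gate {Y : Set X} (hY : IsSubcontinuum Y) :
    Continuous (gate Y) := by
  refine continuous_iff_continuousAt.2 fun x => ?_
  by_cases hx : x ∈ Y
  · rw [Metric.continuousAt_iff]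
    intro ε hε
    obtain ⟨V, -, hV, hVc, hxV, hVd⟩ :=
      exists_open_preconnected_small (half_pos hε) x isOpen_univ (mem_univ x)
    obtain ⟨δ, hδ, hδV⟩ := Metric.isOpen_iff.1 hV x hxV
    refine ⟨δ, hδ, fun {x'} hx' => ?_⟩
    rw [hY.gate_eq_self hx]
    have := seg_subset hVc (hδV hx') hxV (hY.gate_mem_seg x' hx)
    linarith [hVd _ this _ hxV]
  · have hC : connectedComponentIn Yᶜ x ∈ 𝓝 x :=
      hY.isClosed.isOpen_compl.connectedComponentIn.mem_nhds (mem_connectedComponentIn hx)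
    refine continuousAt_const.congr (f := fun _ => gate Y x) ?_
    filter_upwards [hC] with x' hx'
    refine hY.eq_gate (hY.gate_mem x) fun y hy => ?_
    refine (seg_subset_union x x' y (hY.gate_mem_seg x hy)).resolve_left fun h => ?_
    exact connectedComponentIn_subset _ _ (seg_subset isPreconnected_connectedComponentIn
      (mem_connectedComponentIn hx) hx' h) (hY.gate_mem x)

lemma IsSubcontinuum.gate_eq_gate_of_subset {Y Y' : Set X} (hY : IsSubcontinuum Y)
    (hY' : IsSubcontinuum Y') (h : Y ⊆ Y') {x : X} (hx : gate Y' x ∈ Y) : gate Y' x = gate Y x :=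
  hY.eq_gate hx fun _ hy => hY'.gate_mem_seg x (h hy)

lemma IsSubcontinuum.union_seg {Y : Set X} (hY : IsSubcontinuum Y) {v : X} (hv : v ∈ Y) (x : X) :
    IsSubcontinuum (Y ∪ _root_.seg v x) :=
  ⟨hY.isClosed.union (isClosed_seg v x),
    hY.isPreconnected.union v hv (left_mem_seg v x) (isPreconnected_seg v x),
    hY.nonempty.mono subset_union_left⟩

lemma IsSubcontinuum.inter_seg_gate {Y : Set X} (hY : IsSubcontinuum Y) (x : X) :
    Y ∩ _root_.seg (gate Y x) x ⊆ {gate Y x} := by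
  rintro y ⟨hy, h⟩
  rw [seg_comm] at h
  exact eq_of_mem_seg_of_mem_seg h (hY.gate_mem_seg x hy)

end Gates

section Branches

lemma connectedComponents_mk_eq_iff {X : Type*} [TopologicalSpace X] {r x y : X} (hx : x ≠ r)
    (hy : y ≠ r) : ((⟨x, hx⟩ : ({r}ᶜ : Set X)) : ConnectedComponents ({r}ᶜ : Set X)) =
      ((⟨y, hy⟩ : ({r}ᶜ : Set X)) : ConnectedComponents ({r}ᶜ : Set X)) ↔
      connectedComponentIn {r}ᶜ x = connectedComponentIn {r}ᶜ y := by
  rw [ConnectedComponents.coe_eq_coe, connectedComponentIn_eq_image (show x ∈ ({r}ᶜ : Set X) from hx),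
    connectedComponentIn_eq_image (show y ∈ ({r}ᶜ : Set X) from hy)]
  exact (image_injective.2 Subtype.val_injective).eq_iff.symm

variable {X : Type*} [MetricSpace X]

/-- Every complement of a point has only finitely many components meeting `S`. -/
def MeetsFinitelyManyBranches (S : Set X) : Prop :=
  ∀ b, {C | ∃ x ∈ S, x ≠ b ∧ C = connectedComponentIn {b}ᶜ x}.Finite

lemma MeetsFinitelyManyBranches.mono {S T : Set X} (hT : MeetsFinitelyManyBranches T)
    (h : S ⊆ T) : MeetsFinitelyManyBranches S := fun b =>
  (hT b).subset fun _ ⟨x, hx, hC⟩ => ⟨x, h hx, hC⟩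

lemma MeetsFinitelyManyBranches.union {S T : Set X} (hS : MeetsFinitelyManyBranches S)
    (hT : MeetsFinitelyManyBranches T) : MeetsFinitelyManyBranches (S ∪ T) := by
  intro b
  refine ((hS b).union (hT b)).subset ?_
  rintro C ⟨x, hx | hx, h⟩
  · exact Or.inl ⟨x, hx, h⟩
  · exact Or.inr ⟨x, hx, h⟩

variable [CompactSpace X] [LocallyConnectedSpace X] [AcyclicSpace X] [ConnectedSpace X]

lemma connectedComponentIn_compl_singleton_eq_iff {b x y : X} (hx : x ≠ b) (hy : y ≠ b) :
    connectedComponentIn {b}ᶜ x = connectedComponentIn {b}ᶜ y ↔ b ∉ seg x y := by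
  rw [notMem_seg_iff hx.symm]
  exact ⟨fun h => h ▸ mem_connectedComponentIn hy, connectedComponentIn_eq⟩

lemma isBranchPoint_of_mem_seg {r x y z : X} (hx : x ≠ r) (hy : y ≠ r) (hz : z ≠ r)
    (hxy : r ∈ seg x y) (hxz : r ∈ seg x z) (hyz : r ∈ seg y z) : IsBranchPoint r := by
  refine ⟨(⟨x, hx⟩ : ({r}ᶜ : Set X)), (⟨y, hy⟩ : ({r}ᶜ : Set X)), (⟨z, hz⟩ : ({r}ᶜ : Set X)),
    ?_, ?_, ?_⟩
  all_goals
    rw [Ne, connectedComponents_mk_eq_iff, connectedComponentIn_compl_singleton_eq_iff, not_not] <;>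
      assumption

lemma meetsFinitelyManyBranches_seg (p q : X) : MeetsFinitelyManyBranches (seg p q) := by
  intro b
  refine (toFinite {connectedComponentIn {b}ᶜ p, connectedComponentIn {b}ᶜ q}).subset ?_
  rintro C ⟨x, hx, hxb, rfl⟩
  by_cases h1 : b ∈ seg p x
  · right
    have h2 : b ∉ seg x q := fun h2 => hxb (by
      have : b ∈ ({x} : Set X) := seg_inter_seg hx ▸ ⟨h1, h2⟩
      exact this.symm)
    exact (connectedComponentIn_compl_singleton_eq_iff hxb
      (fun h => h2 (h ▸ right_mem_seg x q))).2 h2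
  · left
    rw [seg_comm] at h1
    exact (connectedComponentIn_compl_singleton_eq_iff hxb
      (fun h => h1 (h ▸ right_mem_seg x p))).2 h1

/-- Dense branch points are dense on arcs. -/
lemma IsArcOn.exists_isBranchPoint (hd : Dense {x : X | IsBranchPoint x}) {η : ℝ → X} {s t : ℝ}
    (hη : IsArcOn η s t) : ∃ u ∈ Ioo s t, IsBranchPoint (η u) := by
  have hst := hη.lt
  have hm : (s + t) / 2 ∈ Ioo s t := ⟨by linarith, by linarith⟩
  have hs : s ∈ Icc s t := left_mem_Icc.2 hst.le
  have ht : t ∈ Icc s t := right_mem_Icc.2 hst.le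
  have hU : IsOpen ({η s, η t}ᶜ : Set X) := (toFinite {η s, η t}).isClosed.isOpen_compl
  have hmU : η ((s + t) / 2) ∈ ({η s, η t}ᶜ : Set X) := by
    rintro (h | h)
    · exact hm.1.ne' (hη.inj (Ioo_subset_Icc_self hm) hs h)
    · exact hm.2.ne (hη.inj (Ioo_subset_Icc_self hm) ht h)
  obtain ⟨b, hbU, hb⟩ := hd.exists_mem_open (hU.connectedComponentIn (x := η ((s + t) / 2)))
    ⟨_, mem_connectedComponentIn hmU⟩ |>.imp fun _ h => h.symm
  have hY : IsSubcontinuum (seg (η s) (η t)) := IsSubcontinuum.seg _ _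
  obtain ⟨u, hu, hur⟩ : gate (seg (η s) (η t)) b ∈ η '' Icc s t := by
    rw [hη.image_eq_seg]
    exact hY.gate_mem b
  have hmem : ∀ {y}, y ∈ η '' Icc s t → η u ∈ seg b y := fun {y} hy => by
    rw [hur]
    rw [hη.image_eq_seg] at hy
    exact hY.gate_mem_seg b hy
  have hruU : η u ∈ ({η s, η t}ᶜ : Set X) := connectedComponentIn_subset _ _ <|
    seg_subset isPreconnected_connectedComponentIn hbU (mem_connectedComponentIn hmU)
      (hmem (mem_image_of_mem η (Ioo_subset_Icc_self hm)))
  simp only [mem_compl_iff, mem_insert_iff, mem_singleton_iff, not_or] at hruU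
  refine ⟨u, ⟨lt_of_le_of_ne hu.1 fun h => hruU.1 (by rw [h]),
    lt_of_le_of_ne hu.2 fun h => hruU.2 (by rw [h])⟩, ?_⟩
  by_cases hbr : b = η u
  · rwa [← hbr]
  · exact isBranchPoint_of_mem_seg hbr (Ne.symm hruU.1) (Ne.symm hruU.2)
      (hmem (mem_image_of_mem η hs)) (hmem (mem_image_of_mem η ht))
      (hη.image_eq_seg ▸ mem_image_of_mem η hu)

/-- At a point of infinite order, a small arc ending at a branch point can avoid any set meeting
finitely many branches. -/
lemma exists_small_arc (hd : Dense {x : X | IsBranchPoint x}) {b : X}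
    (hb : Infinite (ConnectedComponents (({b}ᶜ : Set X)))) {S : Set X}
    (hS : MeetsFinitelyManyBranches S) {ε : ℝ} (hε : 0 < ε) :
    ∃ η : ℝ → X, IsArcOn η 0 1 ∧ η 0 = b ∧ IsBranchPoint (η 1) ∧ (∀ t ∈ Ioc (0 : ℝ) 1, η t ∉ S) ∧
      ∀ t ∈ Icc (0 : ℝ) 1, dist (η t) b ≤ ε := by
  obtain ⟨x, hxb, hxS⟩ : ∃ x, x ≠ b ∧ ∀ y ∈ connectedComponentIn {b}ᶜ x, y ∉ S := by
    by_contra! hcon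
    have hfin : (range fun x : ({b}ᶜ : Set X) => connectedComponentIn {b}ᶜ (x : X)).Finite := by
      refine (hS b).subset ?_
      rintro _ ⟨⟨x, hx⟩, rfl⟩
      obtain ⟨y, hy, hyS⟩ := hcon x hx
      exact ⟨y, hyS, connectedComponentIn_subset _ _ hy, connectedComponentIn_eq hy⟩
    have := hfin.to_subtype
    obtain ⟨g, hg⟩ := (ConnectedComponents.surjective_coe
      (α := ({b}ᶜ : Set X))).hasRightInverse
    refine not_finite_iff_infinite.2 hb (Finite.of_injective
      (fun c => (⟨_, g c, rfl⟩ : range fun x : ({b}ᶜ : Set X) =>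
        connectedComponentIn {b}ᶜ (x : X))) fun c c' h => ?_)
    have h' := (connectedComponents_mk_eq_iff (g c).2 (g c').2).2 (congrArg Subtype.val h)
    exact (hg c).symm.trans (h'.trans (hg c'))
  have tail : ∀ {y : X} {γ : ℝ → X}, IsArcOn γ 0 1 → γ 0 = b → γ 1 = y →
      y ∈ connectedComponentIn {b}ᶜ x → ∀ t ∈ Ioc (0 : ℝ) 1,
      γ t ∈ connectedComponentIn {b}ᶜ x := by
    intro y γ hγ h0 h1 hy t ht
    rw [connectedComponentIn_eq hy]
    refine (isPreconnected_Ioc.image γ (hγ.cont.mono Ioc_subset_Icc_self)).subset_connectedComponentIn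
      (h1 ▸ mem_image_of_mem γ (right_mem_Ioc.2 one_pos)) ?_ (mem_image_of_mem γ ht)
    rintro _ ⟨u, hu, rfl⟩ h
    exact hu.1.ne' (hγ.inj (Ioc_subset_Icc_self hu) (by simp) (h.trans h0.symm))
  obtain ⟨V, -, hV, hVc, hbV, hVd⟩ := exists_open_preconnected_small hε b isOpen_univ (mem_univ b)
  obtain ⟨γ, hγ, h0, h1⟩ := exists_arc hxb.symm
  have hγt := tail hγ h0 h1 (mem_connectedComponentIn hxb)
  obtain ⟨t, htV, ht⟩ : ∃ t, γ t ∈ V ∧ t ∈ Ioc (0 : ℝ) 1 := by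
    have h2 : γ ⁻¹' V ∈ 𝓝[Ioc 0 1] (0 : ℝ) :=
      ((hγ.cont 0 (by simp)).mono Ioc_subset_Icc_self).preimage_mem_nhdsWithin
        (hV.mem_nhds (h0 ▸ hbV))
    have h3 : (𝓝[Ioc 0 1] (0 : ℝ)).NeBot := by
      rw [← mem_closure_iff_nhdsWithin_neBot, closure_Ioc zero_ne_one]
      simp
    exact (inter_mem h2 self_mem_nhdsWithin |> h3.nonempty_of_mem)
  have hCo : IsOpen (connectedComponentIn {b}ᶜ x) := isOpen_compl_singleton.connectedComponentIn
  obtain ⟨c, hc, hcV, hcC⟩ := hd.exists_mem_open (hV.inter hCo) ⟨γ t, htV, hγt t ht⟩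
  have hcb : c ≠ b := connectedComponentIn_subset _ _ hcC
  obtain ⟨η, hη, e0, e1⟩ := exists_arc hcb.symm
  refine ⟨η, hη, e0, e1 ▸ hc, fun t ht => hxS _ (tail hη e0 e1 hcC t ht), fun t ht => ?_⟩
  refine hVd _ (seg_subset hVc (e0 ▸ hbV) (e1 ▸ hcV) ?_) _ hbV
  rw [← hη.image_eq_seg]
  exact mem_image_of_mem η ht

end Branches

section Extension

lemma map_mem_seg {X W : Type*} [MetricSpace X] [CompactSpace X] [LocallyConnectedSpace X]
    [AcyclicSpace X] [ConnectedSpace X] [MetricSpace W] [CompactSpace W] [LocallyConnectedSpace W]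
    [AcyclicSpace W] {Y : Set X} (hY : IsPreconnected Y) {e : X → W} (hc : ContinuousOn e Y)
    (hi : InjOn e Y) {p q z : X} (hp : p ∈ Y) (hq : q ∈ Y) (hz : z ∈ seg p q) :
    e z ∈ seg (e p) (e q) := by
  by_cases hpq : p = q
  · rw [hpq, seg_self] at hz
    rw [show z = q from hz]
    exact right_mem_seg _ _
  obtain ⟨γ, hγ, rfl, rfl⟩ := exists_arc hpq
  have hm : MapsTo γ (Icc 0 1) Y := by
    rw [mapsTo_iff_image_subset, hγ.image_eq_seg]
    exact seg_subset hY hp hq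
  have harc : IsArcOn (e ∘ γ) 0 1 :=
    ⟨one_pos, hc.comp hγ.cont hm, hi.comp hγ.inj hm⟩
  rw [← hγ.image_eq_seg] at hz
  have := harc.image_eq_seg
  rw [image_comp] at this
  exact this ▸ mem_image_of_mem e hz

variable {X : Type*} [MetricSpace X]
  {W : Type*} [MetricSpace W] [CompactSpace W] [LocallyConnectedSpace W] [AcyclicSpace W]
  [ConnectedSpace W]

/-- Two arcs can be matched so that a given countable set goes to branch points. -/
lemma exists_arc_map (hd : Dense {x : W | IsBranchPoint x}) {Q : Set X} (hQ : Q.Countable)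
    {γ : ℝ → X} {η : ℝ → W} (hγ : IsArcOn γ 0 1) (hη : IsArcOn η 0 1)
    (hη1 : IsBranchPoint (η 1)) :
    ∃ h : X → W, ContinuousOn h (γ '' Icc 0 1) ∧ InjOn h (γ '' Icc 0 1) ∧ h (γ 0) = η 0 ∧
      MapsTo h (γ '' Icc 0 1) (η '' Icc 0 1) ∧ MapsTo h (γ '' Ioc 0 1) (η '' Ioc 0 1) ∧
      ∀ z ∈ γ '' Ioc 0 1, z ∈ Q → IsBranchPoint (h z) := by
  have hbr : ∀ p : ℚ × ℚ, ∃ u : ℝ, 0 ≤ (p.1 : ℝ) → (p.1 : ℝ) < p.2 → (p.2 : ℝ) ≤ 1 →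
      u ∈ Ioo (p.1 : ℝ) p.2 ∧ IsBranchPoint (η u) := by
    intro p
    by_cases h : 0 ≤ (p.1 : ℝ) ∧ (p.1 : ℝ) < p.2 ∧ (p.2 : ℝ) ≤ 1
    · obtain ⟨u, hu, hu'⟩ := (hη.mono h.1 h.2.1 h.2.2).exists_isBranchPoint hd
      exact ⟨u, fun _ _ _ => ⟨hu, hu'⟩⟩
    · exact ⟨0, fun h1 h2 h3 => (h ⟨h1, h2, h3⟩).elim⟩
  choose u hu using hbr
  let G : Icc (0 : ℝ) 1 → X := fun s => γ s
  have hGc : Continuous G := continuousOn_iff_continuous_domRestrict.1 hγ.cont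
  have hGi : Function.Injective G := fun s t h => Subtype.ext (hγ.inj s.2 t.2 h)
  have hGr : range G = γ '' Icc 0 1 := by rw [image_eq_range]
  obtain ⟨D, hDc, hD⟩ := TopologicalSpace.exists_countable_dense (Icc (0 : ℝ) 1)
  obtain ⟨ψ, ψc, ψm, ψ0, ψ1, ψr, hψ⟩ := exists_continuous_strictMono_onto_Icc
    (K := Icc (0 : ℝ) 1) (a := 0) (b := 1) (fun s => s.2.1) (fun s => s.2.2) zero_lt_one
    (D := D ∪ G ⁻¹' Q) (hDc.union (hQ.preimage hGi)) (hD.mono subset_union_left)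
    (E := range u ∩ {r | r ∈ Ioo 0 1 ∧ IsBranchPoint (η r)}) (fun r hr => hr.2.1)
    ((countable_range u).mono inter_subset_left) (fun s t h0 hst h1 => by
      obtain ⟨p, hp1, hp2⟩ := exists_rat_btwn hst
      obtain ⟨q, hq1, hq2⟩ := exists_rat_btwn hp2
      obtain ⟨h3, h4⟩ := hu (p, q) (h0.trans hp1.le) hq1 (hq2.le.trans h1)
      exact ⟨u (p, q), ⟨⟨_, rfl⟩, ⟨(h0.trans_lt hp1).trans h3.1, h3.2.trans (hq2.trans_le h1)⟩, h4⟩,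
        hp1.trans h3.1, h3.2.trans hq2⟩)
  have hψI : ∀ s, ψ s ∈ Icc (0 : ℝ) 1 := fun s => ψr ▸ mem_range_self s
  have hinv : ∀ s, Function.invFun G (G s) = s := Function.leftInverse_invFun hGi
  have hval : ∀ s : ℝ, ∀ hs : s ∈ Icc (0 : ℝ) 1, Function.invFun G (γ s) = ⟨s, hs⟩ :=
    fun s hs => hinv ⟨s, hs⟩
  have hpos : ∀ s : Icc (0 : ℝ) 1, 0 < (s : ℝ) → 0 < ψ s := fun s hs =>
    ψ0 ▸ ψm (show (0 : Icc (0 : ℝ) 1) < s from hs)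
  refine ⟨fun z => η (ψ (Function.invFun G z)), ?_, ?_, ?_, ?_, ?_, ?_⟩
  · refine hη.cont.comp (ψc.comp_continuousOn ?_) fun _ _ => hψI _
    rw [← hGr, continuousOn_iff_continuous_domRestrict]
    have := (hGc.isClosedEmbedding hGi).isEmbedding.toHomeomorph.symm.continuous
    refine this.congr fun z => ?_
    obtain ⟨_, s, rfl⟩ := z
    exact ((hinv s).trans ((hGc.isClosedEmbedding hGi).isEmbedding.toHomeomorph.symm_apply_apply s).symm).symm
  · rintro _ ⟨s, hs, rfl⟩ _ ⟨t, ht, rfl⟩ h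
    simp only [hval s hs, hval t ht] at h
    have := congrArg Subtype.val (ψm.injective (hη.inj (hψI _) (hψI _) h))
    exact congrArg γ this
  · simp only [hval 0 (by simp)]
    exact congrArg η ψ0
  · rintro _ ⟨s, hs, rfl⟩
    exact mem_image_of_mem η (hψI _)
  · rintro _ ⟨s, hs, rfl⟩
    have hs' := Ioc_subset_Icc_self hs
    simp only [hval s hs']
    exact mem_image_of_mem η ⟨hpos _ hs.1, (hψI _).2⟩
  · rintro _ ⟨s, hs, rfl⟩ hsQ
    have hs' := Ioc_subset_Icc_self hs
    simp only [hval s hs']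
    by_cases h1 : (⟨s, hs'⟩ : Icc (0 : ℝ) 1) = 1
    · rw [h1, ψ1]
      exact hη1
    · exact (hψ ⟨s, hs'⟩ (Or.inr hsQ) (fun h => hs.1.ne' (congrArg Subtype.val h)) h1).2.2

/-- An embedding of `Y` into `W` sending `P` to `w` and points of `Q` to branch points, whose image
meets only finitely many branches at every point. -/
structure IsPartialEmbedding (P : X) (w : W) (Q Y : Set X) (e : X → W) : Prop where
  cont : ContinuousOn e Y
  inj : InjOn e Y
  mem : P ∈ Y
  map : e P = w
  branch : ∀ z ∈ Y, z ∈ Q → IsBranchPoint (e z)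
  finite : MeetsFinitelyManyBranches (e '' Y)

variable [CompactSpace X] [LocallyConnectedSpace X] [AcyclicSpace X] [ConnectedSpace X]

lemma IsPartialEmbedding.exists_extension (hd : Dense {x : W | IsBranchPoint x})
    (hb : ∀ x : W, IsBranchPoint x → HasAlephNullBranchesAt W x) {P : X} {w : W} {Q Y : Set X}
    (hQ : Q.Countable) {e : X → W} (he : IsPartialEmbedding P w Q Y e) (hY : IsSubcontinuum Y)
    {x : X} (hx : gate Y x ∈ Q) {ε : ℝ} (hε : 0 < ε) :
    ∃ e' : X → W, IsPartialEmbedding P w Q (Y ∪ seg (gate Y x) x) e' ∧ EqOn e' e Y ∧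
      ∀ z ∈ seg (gate Y x) x, dist (e' z) (e (gate Y x)) ≤ ε := by
  classical
  by_cases hxY : x ∈ Y
  · refine ⟨e, ?_, fun _ _ => rfl, ?_⟩
    · rwa [hY.gate_eq_self hxY, seg_self, union_eq_left.2 (singleton_subset_iff.2 hxY)]
    · rw [hY.gate_eq_self hxY, seg_self]
      rintro _ rfl
      rw [dist_self]
      exact hε.le
  have hvx : gate Y x ≠ x := fun h => hxY (h ▸ hY.gate_mem x)
  obtain ⟨γ, hγ, γ0, γ1⟩ := exists_arc hvx
  obtain ⟨η, hη, η0, η1, ηe, ηd⟩ := exists_small_arc hd (hb _ (he.branch _ (hY.gate_mem x) hx)).2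
    he.finite hε
  obtain ⟨h, hc, hi, h0, hm, hm', hbr⟩ := exists_arc_map hd hQ hγ hη η1
  have hseg : γ '' Icc 0 1 = seg (gate Y x) x := by rw [hγ.image_eq_seg, γ0, γ1]
  have hpos : ∀ z ∈ seg (gate Y x) x, z ∉ Y → z ∈ γ '' Ioc 0 1 := by
    intro z hz hzY
    rw [← hseg] at hz
    obtain ⟨s, hs, rfl⟩ := hz
    refine ⟨s, ⟨lt_of_le_of_ne hs.1 fun h => hzY ?_, hs.2⟩, rfl⟩
    rw [← h, γ0]
    exact hY.gate_mem x
  rw [hseg] at hc hi hm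
  let e' : X → W := fun z => if z ∈ Y then e z else h z
  have e1 : EqOn e' e Y := fun z hz => if_pos hz
  have e2 : EqOn e' h (seg (gate Y x) x) := fun z hz => by
    by_cases hzY : z ∈ Y
    · have : z = gate Y x := hY.inter_seg_gate x ⟨hzY, hz⟩
      rw [e1 hzY, this, ← γ0, h0, η0, γ0]
    · exact if_neg hzY
  have cross : ∀ z ∈ Y, ∀ z' ∈ seg (gate Y x) x, z' ∉ Y → e' z ≠ e' z' := by
    intro z hz z' hz' hz'Y heq
    rw [e1 hz, e2 hz'] at heq
    obtain ⟨t, ht, hte⟩ := hm' (hpos z' hz' hz'Y)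
    exact ηe t ht (hte ▸ heq ▸ mem_image_of_mem e hz)
  refine ⟨e', ⟨?_, ?_, Or.inl he.mem, (e1 he.mem).trans he.map, ?_, ?_⟩, e1, ?_⟩
  · exact (he.cont.congr e1).union_of_isClosed (hc.congr e2) hY.isClosed (isClosed_seg _ _)
  · intro z hz z' hz' heq
    by_cases h1 : z ∈ Y <;> by_cases h2 : z' ∈ Y
    · exact he.inj h1 h2 (by rwa [e1 h1, e1 h2] at heq)
    · exact (cross z h1 z' (hz'.resolve_left h2) h2 heq).elim
    · exact (cross z' h2 z (hz.resolve_left h1) h1 heq.symm).elim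
    · have h3 := hz.resolve_left h1
      have h4 := hz'.resolve_left h2
      exact hi h3 h4 (by rwa [e2 h3, e2 h4] at heq)
  · intro z hz hzQ
    by_cases h1 : z ∈ Y
    · rw [e1 h1]
      exact he.branch z h1 hzQ
    · have h3 := hz.resolve_left h1
      rw [e2 h3]
      exact hbr z (hpos z h3 h1) hzQ
  · refine (he.finite.union (meetsFinitelyManyBranches_seg (η 0) (η 1))).mono ?_
    rw [image_union, e1.image_eq, e2.image_eq, ← hη.image_eq_seg]
    exact union_subset_union_right _ (image_subset_iff.2 hm)
  · intro z hz
    rw [e2 hz]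
    obtain ⟨t, ht, hte⟩ := hm hz
    rw [← hte]
    exact ηd t ht

end Extension

section Exhaustion

variable {X : Type*} [MetricSpace X]

/-- Finite trees spanned by `P` and the first points of the sequence `x`. -/
noncomputable def spannedTree (P : X) (x : ℕ → X) : ℕ → Set X
  | 0 => {P}
  | n + 1 => spannedTree P x n ∪ seg (gate (spannedTree P x n) (x n)) (x n)

lemma monotone_spannedTree (P : X) (x : ℕ → X) : Monotone (spannedTree P x) :=
  monotone_nat_of_le_succ fun _ => subset_union_left

variable [CompactSpace X] [LocallyConnectedSpace X] [AcyclicSpace X] [ConnectedSpace X]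

lemma isSubcontinuum_spannedTree (P : X) (x : ℕ → X) (n : ℕ) :
    IsSubcontinuum (spannedTree P x n) := by
  induction n with
  | zero => exact ⟨isClosed_singleton, isPreconnected_singleton, singleton_nonempty P⟩
  | succ n ih => exact ih.union_seg (ih.gate_mem _) _

lemma exists_mem_spannedTree {x : ℕ → X} (hx : DenseRange x) (P : X) {p q z : X} (hzp : z ≠ p)
    (hzq : z ≠ q) (hz : z ∈ seg p q) : ∃ n, z ∈ spannedTree P x n := by
  have ho : ∀ y, IsOpen (connectedComponentIn {z}ᶜ y) := fun _ =>
    isOpen_compl_singleton.connectedComponentIn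
  obtain ⟨i, hi⟩ := hx.exists_mem_open (ho p) ⟨p, mem_connectedComponentIn hzp.symm⟩
  obtain ⟨j, hj⟩ := hx.exists_mem_open (ho q) ⟨q, mem_connectedComponentIn hzq.symm⟩
  have hij : z ∈ seg (x i) (x j) := by
    have hiz : x i ≠ z := connectedComponentIn_subset _ _ hi
    have hjz : x j ≠ z := connectedComponentIn_subset _ _ hj
    by_contra h
    rw [← connectedComponentIn_compl_singleton_eq_iff hiz hjz, ← connectedComponentIn_eq hi,
      ← connectedComponentIn_eq hj, connectedComponentIn_compl_singleton_eq_iff hzp.symm hzq.symm] at h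
    exact h hz
  have hxm : ∀ n, x n ∈ spannedTree P x (n + 1) := fun n => Or.inr (right_mem_seg _ _)
  exact ⟨max (i + 1) (j + 1), seg_subset (isSubcontinuum_spannedTree P x _).isPreconnected
    (monotone_spannedTree P x (le_max_left _ _) (hxm i))
    (monotone_spannedTree P x (le_max_right _ _) (hxm j)) hij⟩

/-- Distinct points are separated by two distinct points of some spanned tree. -/
lemma exists_separating_pair {x : ℕ → X} (hx : DenseRange x) (P : X) {p q : X} (hpq : p ≠ q) :
    ∃ n, ∃ z₁ ∈ spannedTree P x n, ∃ z₂ ∈ spannedTree P x n, z₁ ≠ z₂ ∧ z₁ ∈ seg p z₂ ∧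
      z₂ ∈ seg q z₁ := by
  obtain ⟨γ, hγ, rfl, rfl⟩ := exists_arc hpq
  have mem : ∀ {a b c : ℝ}, 0 ≤ a → a < b → b ≤ 1 → a ≤ c → c ≤ b → γ c ∈ seg (γ a) (γ b) := by
    intro a b c h1 h2 h3 h4 h5
    rw [← (hγ.mono h1 h2 h3).image_eq_seg]
    exact mem_image_of_mem γ ⟨h4, h5⟩
  have ne : ∀ {a b : ℝ}, 0 ≤ a → a < b → b ≤ 1 → γ a ≠ γ b := fun h1 h2 h3 h =>
    h2.ne (hγ.inj ⟨h1, h2.le.trans h3⟩ ⟨h1.trans h2.le, h3⟩ h)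
  obtain ⟨i, hi⟩ := exists_mem_spannedTree hx P (z := γ (1 / 3)) (p := γ 0) (q := γ 1)
    (ne (by norm_num) (by norm_num) (by norm_num)).symm
    (ne (by norm_num) (by norm_num) (by norm_num))
    (mem (by norm_num) (by norm_num) (by norm_num) (by norm_num) (by norm_num))
  obtain ⟨j, hj⟩ := exists_mem_spannedTree hx P (z := γ (2 / 3)) (p := γ 0) (q := γ 1)
    (ne (by norm_num) (by norm_num) (by norm_num)).symm
    (ne (by norm_num) (by norm_num) (by norm_num))
    (mem (by norm_num) (by norm_num) (by norm_num) (by norm_num) (by norm_num))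
  refine ⟨max i j, γ (1 / 3), monotone_spannedTree P x (le_max_left _ _) hi, γ (2 / 3),
    monotone_spannedTree P x (le_max_right _ _) hj,
    ne (by norm_num) (by norm_num) (by norm_num),
    mem (by norm_num) (by norm_num) (by norm_num) (by norm_num) (by norm_num), ?_⟩
  rw [seg_comm]
  exact mem (by norm_num) (by norm_num) (by norm_num) (by norm_num) (by norm_num)

/-- Retracting onto `Y` preserves betweenness of points of `Y`. -/
lemma IsSubcontinuum.mem_seg_gate {Y : Set X} (hY : IsSubcontinuum Y) {p z₁ z₂ : X}
    (h₁ : z₁ ∈ Y) (h : z₁ ∈ _root_.seg p z₂) : z₁ ∈ _root_.seg (gate Y p) z₂ := by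
  rcases seg_subset_union p (gate Y p) z₂ h with h | h
  · rw [eq_of_mem_seg_of_mem_seg h (hY.gate_mem_seg p h₁)]
    exact left_mem_seg _ _
  · exact h

/-- The retraction onto `Y` collapses an attached segment. -/
lemma IsSubcontinuum.gate_union_seg {Y : Set X} (hY : IsSubcontinuum Y) (a p : X) :
    gate (Y ∪ _root_.seg (gate Y a) a) p = gate Y p ∨
      gate (Y ∪ _root_.seg (gate Y a) a) p ∈ _root_.seg (gate Y a) a ∧ gate Y p = gate Y a := by
  have hY' := hY.union_seg (hY.gate_mem a) a
  set r := gate (Y ∪ _root_.seg (gate Y a) a) p with hr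
  by_cases h : r ∈ Y
  · exact Or.inl (hY.gate_eq_gate_of_subset hY' subset_union_left h)
  have hrs : r ∈ _root_.seg (gate Y a) a := (hY'.gate_mem p).resolve_left h
  refine Or.inr ⟨hrs, (hY.eq_gate (hY.gate_mem a) fun y hy => ?_).symm⟩
  refine seg_subset_seg_right (hY'.gate_mem_seg p (Or.inl hy)) ?_
  refine (seg_subset_union a r y (hY.gate_mem_seg a hy)).resolve_left fun h1 => h ?_
  rw [seg_comm] at hrs
  rw [← eq_of_mem_seg_of_mem_seg h1 hrs]
  exact hY.gate_mem a

end Exhaustion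

section Main

variable {X : Type*} [MetricSpace X] [CompactSpace X] [LocallyConnectedSpace X] [AcyclicSpace X]
  [ConnectedSpace X] {W : Type*} [MetricSpace W] [CompactSpace W] [LocallyConnectedSpace W]
  [AcyclicSpace W] [ConnectedSpace W]

lemma exists_isEmbedding_of_dense_isBranchPoint (hd : Dense {x : W | IsBranchPoint x})
    (hb : ∀ x : W, IsBranchPoint x → HasAlephNullBranchesAt W x) (w : W) (hw : IsBranchPoint w)
    (P : X) : ∃ f : X → W, IsEmbedding f ∧ f P = w := by
  obtain ⟨x, hx⟩ := TopologicalSpace.exists_dense_seq X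
  let Y := spannedTree P x
  have hY : ∀ n, IsSubcontinuum (Y n) := isSubcontinuum_spannedTree P x
  let Q : Set X := range fun n => gate (Y n) (x n)
  have hQ : Q.Countable := countable_range _
  have base : IsPartialEmbedding P w Q (Y 0) fun _ => w :=
    ⟨continuousOn_const, injOn_singleton _ _, rfl, rfl, fun _ _ _ => hw,
      (meetsFinitelyManyBranches_seg w w).mono (by
        rintro _ ⟨_, -, rfl⟩
        exact left_mem_seg w w)⟩
  have step : ∀ n, ∀ e : {e : X → W // IsPartialEmbedding P w Q (Y n) e},
      ∃ e' : {e : X → W // IsPartialEmbedding P w Q (Y (n + 1)) e}, EqOn e'.1 e.1 (Y n) ∧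
        ∀ z ∈ seg (gate (Y n) (x n)) (x n),
          dist (e'.1 z) (e.1 (gate (Y n) (x n))) ≤ 1 * (1 / 2) ^ n := by
    rintro n ⟨e, he⟩
    obtain ⟨e', he', h⟩ := he.exists_extension hd hb hQ (hY n) (mem_range_self n)
      (ε := 1 * (1 / 2) ^ n) (by positivity)
    exact ⟨⟨e', he'⟩, h⟩
  choose F hF hFd using step
  let E : ∀ n, {e : X → W // IsPartialEmbedding P w Q (Y n) e} :=
    fun n => Nat.rec ⟨_, base⟩ F n
  have hE : ∀ n m, n ≤ m → EqOn (E m).1 (E n).1 (Y n) := by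
    intro n m hnm
    induction m, hnm using Nat.le_induction with
    | base => exact fun _ _ => rfl
    | succ m hm ih =>
      exact fun z hz => (hF m (E m) (monotone_spannedTree P x hm hz)).trans (ih hz)
  let f : ℕ → X → W := fun n p => (E n).1 (gate (Y n) p)
  have hfc : ∀ n, Continuous (f n) := fun n =>
    (E n).2.cont.comp_continuous (hY n).continuous_gate (hY n).gate_mem
  have hfd : ∀ p n, dist (f n p) (f (n + 1) p) ≤ 1 * (1 / 2) ^ n := by
    intro p n
    rw [dist_comm]
    rcases (hY n).gate_union_seg (x n) p with h | ⟨h, h'⟩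
    · have : f (n + 1) p = f n p := by
        change (E (n + 1)).1 (gate (Y n ∪ seg (gate (Y n) (x n)) (x n)) p) = _
        rw [h]
        exact hF n (E n) ((hY n).gate_mem p)
      rw [this, dist_self]
      positivity
    · change dist ((E (n + 1)).1 (gate (Y n ∪ seg (gate (Y n) (x n)) (x n)) p))
        ((E n).1 (gate (Y n) p)) ≤ _
      rw [h']
      exact hFd n (E n) _ h
  choose g hg using fun p => cauchySeq_tendsto_of_complete
    (cauchySeq_of_le_geometric (1 / 2) 1 (by norm_num) (hfd p))
  have hgd : ∀ p n, dist (f n p) (g p) ≤ 1 * (1 / 2) ^ n / (1 - 1 / 2) := fun p n =>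
    dist_le_of_le_geometric_of_tendsto (1 / 2) 1 (by norm_num) (hfd p) (hg p) n
  have hlim : Tendsto (fun n : ℕ => 1 * (1 / 2 : ℝ) ^ n / (1 - 1 / 2)) atTop (𝓝 0) := by
    have := ((tendsto_pow_atTop_nhds_zero_of_lt_one (r := (1 / 2 : ℝ)) (by norm_num)
      (by norm_num)).const_mul 1).div_const (1 - 1 / 2)
    simpa only [mul_zero, zero_div] using this
  have hunif : TendstoUniformly f g atTop := by
    rw [Metric.tendstoUniformly_iff]
    intro ε hε
    filter_upwards [hlim.eventually (gt_mem_nhds hε)] with n hn p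
    rw [dist_comm]
    exact (hgd p n).trans_lt hn
  have hgc : Continuous g := hunif.continuous (Frequently.of_forall hfc)
  have key : ∀ {n : ℕ} {p z₁ z₂ : X}, z₁ ∈ Y n → z₂ ∈ Y n → z₁ ∈ seg p z₂ →
      (E n).1 z₁ ∈ seg (g p) ((E n).1 z₂) := by
    intro n p z₁ z₂ h₁ h₂ h
    refine (isClosed_setOf_mem_seg _ _).mem_of_tendsto (hg p) ?_
    filter_upwards [eventually_ge_atTop n] with m hm
    have hnm := monotone_spannedTree P x hm
    have := map_mem_seg (hY m).isPreconnected (E m).2.cont (E m).2.inj ((hY m).gate_mem p)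
      (hnm h₂) ((hY m).mem_seg_gate (hnm h₁) h)
    rwa [hE n m hm h₁, hE n m hm h₂] at this
  have hgi : Function.Injective g := by
    intro p q hpq
    by_contra hne
    obtain ⟨n, z₁, h₁, z₂, h₂, h12, hp, hq⟩ := exists_separating_pair hx P hne
    have k1 := key h₁ h₂ hp
    have k2 := key h₂ h₁ hq
    rw [← hpq] at k2
    exact h12 ((E n).2.inj h₁ h₂ (eq_of_mem_seg_of_mem_seg k1 k2))
  refine ⟨g, (hgc.isClosedEmbedding hgi).isEmbedding, ?_⟩
  refine tendsto_nhds_unique (hg P) (tendsto_const_nhds.congr fun n => ?_)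
  change w = (E n).1 (gate (Y n) P)
  rw [(hY n).gate_eq_self (E n).2.mem, (E n).2.map]

end Main

/-- If `W` is a dendrite whose branch points are dense and with ℵ₀ branches
at each branch point, and `w` is a branch point of `W`, then every pointed dendrite
`(X, P)` embeds into `(W, w)`. -/
theorem pointed_dendrite_embeds_in_universal_dendrite
    {W : Type u} [TopologicalSpace W] (hW : IsDendrite W)
    (hdense : Dense {x : W | IsBranchPoint x})
    (hbranch : ∀ x : W, IsBranchPoint x → HasAlephNullBranchesAt W x)
    (w : W) (hw : IsBranchPoint w)
    {X : Type v} [TopologicalSpace X] (hX : IsDendrite X) (P : X) :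
    ∃ f : X → W, Topology.IsEmbedding f ∧ f P = w := by
  obtain ⟨⟨-, hW1, hW2, hW3⟩, hW4, hW5⟩ := hW
  obtain ⟨⟨-, hX1, hX2, hX3⟩, hX4, hX5⟩ := hX
  let _ := TopologicalSpace.metrizableSpaceMetric W
  let _ := TopologicalSpace.metrizableSpaceMetric X
  have : AcyclicSpace W := ⟨hW5⟩
  have : AcyclicSpace X := ⟨hX5⟩
  exact exists_isEmbedding_of_dense_isBranchPoint hdense hbranch w hw P
end
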